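/- arXiv:2402.17839 — 3 statements merged into one kernel-verified Lean document; each statement's English description precedes it below -/
import Mathlib

section
/- Let F be an arbitrary field, k ≥ 2, and n ≥ k. The height of the ideal I_{k,n} generated by the permanents of all k×k submatrices of the generic k×n matrix satisfies n − k + 1 ≤ Ideal.height I_{k,n} ≤ n; equivalently, the codimension of P_{k,n} = {prk(M) ≤ k−1} in F^{k×n} is between n−k+1 and n. -/
open MvPolynomial

noncomputable section

/-- The permanent of a square matrix. -/
def perm {R : Type*} [CommRing R] {m : ℕ} (A : Matrix (Fin m) (Fin m) R) : R :=
  ∑ σ : Equiv.Perm (Fin m), ∏ i, A i (σ i)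

/-- The height of an ideal: the infimum of the heights (in the prime spectrum)
of the primes containing it. -/
def idealHeight {R : Type*} [CommRing R] (I : Ideal R) : ℕ∞ :=
  ⨅ (p : PrimeSpectrum R) (_ : I ≤ p.asIdeal), Order.height p

/-- The maximal permanental ideal `I_{k,n}`: the ideal generated by the permanents of all
`k × k` submatrices of the generic `k × n` matrix, obtained by selecting `k` of the `n`
columns via a strictly monotone map. -/
def permanentalIdeal (F : Type*) [Field F] (k n : ℕ) :
    Ideal (MvPolynomial (Fin k × Fin n) F) :=
  Ideal.span { p | ∃ c : Fin k → Fin n, StrictMono c ∧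
    p = perm (Matrix.of fun i j => X (i, c j)) }

theorem perm_eq_prod_diag {R : Type*} [CommRing R] {m : ℕ} (A : Matrix (Fin m) (Fin m) R)
    (hA : ∀ i j, j < i → A i j = 0) : perm A = ∏ i, A i i := by
  unfold perm
  rw [Finset.sum_eq_single (1 : Equiv.Perm (Fin m))]
  · simp
  · intro σ _ hσ
    have : ∃ i, σ i < i := by
      by_contra! h
      apply hσ
      have hsum : ∑ i, ((i : Fin m) : ℕ) = ∑ i, ((σ i : Fin m) : ℕ) :=
        (Equiv.sum_comp σ (fun i : Fin m => (i : ℕ))).symm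
      have := (Finset.sum_eq_sum_iff_of_le (fun i _ => Fin.le_def.1 (h i))).1 hsum
      ext i
      simpa using (this i (Finset.mem_univ i)).symm
    obtain ⟨i, hi⟩ := this
    exact Finset.prod_eq_zero (Finset.mem_univ i) (hA _ _ hi)
  · simp

theorem map_perm {R S : Type*} [CommRing R] [CommRing S] (f : R →+* S) {m : ℕ}
    (A : Matrix (Fin m) (Fin m) R) : f (perm A) = perm (A.map f) := by
  simp [perm, map_sum, map_prod]

theorem perm_smul {R : Type*} [CommRing R] {m : ℕ} (r : R) (A : Matrix (Fin m) (Fin m) R) :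
    perm (r • A) = r ^ m * perm A := by
  simp [perm, Finset.mul_sum, Finset.prod_mul_distrib]

/-- The banded Toeplitz matrix whose first row consists of the first `n - k + 1` entries of the
first row of `M`. -/
def toeplitzBand {R : Type*} [Zero R] {k n : ℕ} (M : Matrix (Fin k) (Fin n) R) :
    Matrix (Fin k) (Fin n) R := fun i j =>
  if i.val ≤ j.val ∧ j.val ≤ i.val + (n - k) then
    M ⟨0, i.pos⟩ ⟨j.val - i.val, (Nat.sub_le _ _).trans_lt j.isLt⟩ else 0

theorem map_toeplitzBand {R S : Type*} [Semiring R] [Semiring S] (f : R →+* S) {k n : ℕ}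
    (M : Matrix (Fin k) (Fin n) R) (i : Fin k) (j : Fin n) :
    f (toeplitzBand M i j) = toeplitzBand (M.map f) i j := by
  unfold toeplitzBand
  split_ifs <;> simp

theorem eq_zero_of_eq_toeplitzBand {R : Type*} [CommRing R] [IsReduced R] {k n : ℕ} (hn : k ≤ n)
    (M : Matrix (Fin k) (Fin n) R) (hM : M = toeplitzBand M)
    (hperm : ∀ c : Fin k → Fin n, StrictMono c → perm (Matrix.of fun i j => M i (c j)) = 0) :
    M = 0 := by
  rcases Nat.eq_zero_or_pos k with rfl | hk
  · ext i
    exact i.elim0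
  have key : ∀ c (hc : c ≤ n - k), M ⟨0, hk⟩ ⟨c, by omega⟩ = 0 := by
    intro c
    induction c using Nat.strong_induction_on with
    | _ c ih =>
      intro hc
      have h := hperm (fun j => ⟨c + j.val, by omega⟩) fun a b hab => by
        rw [Fin.lt_def] at hab ⊢
        exact Nat.add_lt_add_left hab c
      rw [perm_eq_prod_diag] at h
      · have hd : ∀ i : Fin k, M i ⟨c + i.val, by omega⟩ = M ⟨0, hk⟩ ⟨c, by omega⟩ := by
          intro i
          rw [hM]
          unfold toeplitzBand
          rw [if_pos ⟨by simp, by simp; omega⟩, if_pos ⟨by simp, by simp; omega⟩]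
          simp
        simp only [Matrix.of_apply] at h
        rw [Finset.prod_congr rfl fun i _ => hd i, Finset.prod_const] at h
        exact eq_zero_of_pow_eq_zero h
      · intro i j hij
        rw [Matrix.of_apply, hM]
        unfold toeplitzBand
        split_ifs with hb
        · simp only at hb
          exact ih _ (by simp only; omega) (by simp only; omega)
        · rfl
  ext i j
  rw [hM]
  unfold toeplitzBand
  split_ifs with hb
  · exact key _ (by omega)
  · rfl

theorem isIntegral_of_sub_toeplitzBand {A K : Type*} [CommRing A] [Field K] [Algebra A K] {k n : ℕ}
    (hn : k ≤ n) (M : Matrix (Fin k) (Fin n) K)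
    (hM : ∀ i j, IsIntegral A (M i j - toeplitzBand M i j))
    (hperm : ∀ c : Fin k → Fin n, StrictMono c → perm (Matrix.of fun i j => M i (c j)) = 0)
    (i : Fin k) (j : Fin n) : IsIntegral A (M i j) := by
  classical
  have : IsIntegrallyClosedIn (integralClosure A K).toSubring K :=
    inferInstanceAs (IsIntegrallyClosedIn (integralClosure A K) K)
  change M i j ∈ (integralClosure A K).toSubring
  rw [Subring.eq_iInf_of_isIntegrallyClosedIn (R := (integralClosure A K).toSubring)]
  simp only [Subring.mem_iInf]
  rintro ⟨V, hV⟩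
  by_contra hij
  obtain ⟨⟨i₀, j₀⟩, -, hmax⟩ := Finset.exists_max_image (Finset.univ : Finset (Fin k × Fin n))
    (fun t => V.valuation (M t.1 t.2)) ⟨(i, j), Finset.mem_univ _⟩
  set g := M i₀ j₀
  have hg1 : 1 < V.valuation g := by
    refine lt_of_lt_of_le ?_ (hmax (i, j) (Finset.mem_univ _))
    rw [← not_le, V.valuation_le_one_iff]
    exact hij
  have hg0 : g ≠ 0 := by
    intro h
    simp [h] at hg1
  have hgpos : 0 < V.valuation g := zero_lt_one.trans hg1
  have hmem : ∀ i j, g⁻¹ * M i j ∈ V := by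
    intro i j
    rw [← V.valuation_le_one_iff, map_mul, map_inv₀, inv_mul_le_iff₀ hgpos, mul_one]
    exact hmax (i, j) (Finset.mem_univ _)
  let N : Matrix (Fin k) (Fin n) V := Matrix.of fun i j => ⟨g⁻¹ * M i j, hmem i j⟩
  let ι : V →+* K := V.subtype
  have hN : N.map ι = g⁻¹ • M := rfl
  let ρ := IsLocalRing.residue V
  have hzero : N.map ρ = 0 := by
    apply eq_zero_of_eq_toeplitzBand hn
    · ext i j
      rw [← map_toeplitzBand, Matrix.map_apply, ← sub_eq_zero, ← map_sub,
        IsLocalRing.residue_eq_zero_iff, V.valuation_lt_one_iff]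
      change V.valuation (ι (N i j - toeplitzBand N i j)) < 1
      have : ι (N i j - toeplitzBand N i j) = g⁻¹ * (M i j - toeplitzBand M i j) := by
        rw [map_sub, map_toeplitzBand, hN, mul_sub]
        congr 1
        unfold toeplitzBand
        split_ifs <;> simp
      rw [this, map_mul, map_inv₀, inv_mul_lt_iff₀ hgpos, mul_one]
      refine lt_of_le_of_lt ?_ hg1
      rw [V.valuation_le_one_iff]
      exact hV (hM i j)
    · intro c hc
      have h0 : perm (Matrix.of fun i j => N i (c j)) = 0 := by
        apply V.subtype_injective
        rw [map_perm, map_zero]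
        have : (Matrix.of fun i j => N i (c j)).map V.subtype
            = g⁻¹ • Matrix.of fun i j => M i (c j) := rfl
        rw [this, perm_smul, hperm c hc, mul_zero]
      have := map_perm ρ (Matrix.of fun i j => N i (c j))
      rw [h0, map_zero] at this
      exact this.symm
  have h1 : N i₀ j₀ = 1 := Subtype.ext (inv_mul_cancel₀ hg0)
  have := congrFun (congrFun hzero i₀) j₀
  rw [Matrix.map_apply, h1, map_one] at this
  exact one_ne_zero this

theorem height_comap_C_add_one_le {B : Type*} [CommRing B] [IsNoetherianRing B]
    (P : Ideal (Polynomial B)) [P.IsPrime] {f : Polynomial B} (hf : f.Monic) (hfP : f ∈ P) :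
    (P.comap Polynomial.C).height + 1 ≤ P.height := by
  set p := P.comap Polynomial.C
  have : p.IsPrime := Ideal.IsPrime.comap _
  have : (p.map Polynomial.C).IsPrime := Ideal.isPrime_map_C_of_isPrime
  have hle : p.map Polynomial.C ≤ P := Ideal.map_comap_le
  have hover : (p.map Polynomial.C).LiesOver p := by
    refine ⟨le_antisymm Ideal.le_comap_map ?_⟩
    exact Ideal.comap_mono hle
  have hheight : p.height ≤ (p.map Polynomial.C).height := by
    rw [Ideal.height_eq_height_add_of_liesOver_of_hasGoingDown p (p.map Polynomial.C)]
    exact le_self_add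
  have hlt : p.map Polynomial.C < P := by
    refine lt_of_le_of_ne hle fun h => ?_
    rw [← h, Ideal.mem_map_C_iff] at hfP
    have := hfP f.natDegree
    rw [hf.coeff_natDegree] at this
    exact (Ideal.ne_top_iff_one p).1 (Ideal.IsPrime.ne_top ‹_›) this
  calc p.height + 1 ≤ (p.map Polynomial.C).height + 1 := by gcongr
    _ ≤ P.height := Ideal.height_add_one_le_of_lt_of_isPrime hlt

theorem le_height_of_monic_eval₂_mem {A : Type*} [CommRing A] [IsNoetherianRing A] (d : ℕ)
    (P : Ideal (MvPolynomial (Fin d) A)) [P.IsPrime]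
    (h : ∀ i, ∃ f : Polynomial A, f.Monic ∧ f.eval₂ C (X i) ∈ P) : (d : ℕ∞) ≤ P.height := by
  induction d with
  | zero => simp
  | succ d ih =>
    let e := (finSuccEquiv A d).toRingEquiv
    let Q : Ideal (Polynomial (MvPolynomial (Fin d) A)) := P.comap e.symm
    have hQ : Q.height = P.height := RingEquiv.height_comap e.symm P
    have hmem : ∀ (i : Fin (d + 1)) (f : Polynomial A), f.eval₂ C (X i) ∈ P →
        f.eval₂ (Polynomial.C.comp C) (finSuccEquiv A d (X i)) ∈ Q := by
      intro i f hf
      have : f.eval₂ (Polynomial.C.comp C) (finSuccEquiv A d (X i)) = e (f.eval₂ C (X i)) := by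
        rw [← RingEquiv.coe_toRingHom, Polynomial.hom_eval₂]
        congr 1
        ext a : 1
        simp [e, finSuccEquiv_apply]
      rw [this]
      change e.symm (e _) ∈ P
      simpa using hf
    obtain ⟨f, hf, hfP⟩ := h 0
    have h0 := hmem 0 f hfP
    rw [finSuccEquiv_X_zero, ← Polynomial.eval₂_map, Polynomial.eval₂_C_X] at h0
    have h1 := height_comap_C_add_one_le Q (hf.map C) h0
    have h2 := ih (Q.comap Polynomial.C) fun i => by
      obtain ⟨f, hf, hfP⟩ := h i.succ
      refine ⟨f, hf, ?_⟩
      have := hmem i.succ f hfP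
      rwa [finSuccEquiv_X_succ, ← Polynomial.hom_eval₂] at this
    rw [← hQ]
    push_cast
    exact le_trans (by gcongr) h1

theorem exists_monic_eval₂_mem {A S : Type*} [CommRing A] [CommRing S] [Algebra A S] (Q : Ideal S)
    [Q.IsPrime] {k n : ℕ} (hn : k ≤ n) (M : Matrix (Fin k) (Fin n) S)
    (hM : ∀ i j, M i j - toeplitzBand M i j ∈ Set.range (algebraMap A S))
    (hperm : ∀ c : Fin k → Fin n, StrictMono c → perm (Matrix.of fun i j => M i (c j)) ∈ Q)
    (i : Fin k) (j : Fin n) :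
    ∃ f : Polynomial A, f.Monic ∧ f.eval₂ (algebraMap A S) (M i j) ∈ Q := by
  let K := FractionRing (S ⧸ Q)
  let π : S →+* K := (algebraMap (S ⧸ Q) K).comp (Ideal.Quotient.mk Q)
  have hπ : ∀ x, π x = 0 ↔ x ∈ Q := fun x => by
    rw [RingHom.comp_apply, map_eq_zero_iff _ (IsFractionRing.injective _ K),
      Ideal.Quotient.eq_zero_iff_mem]
  have hπA : π.comp (algebraMap A S) = algebraMap A K := rfl
  have hint : IsIntegral A (M.map π i j) := by
    refine isIntegral_of_sub_toeplitzBand hn (M.map π) ?_ ?_ _ _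
    · intro i j
      obtain ⟨a, ha⟩ := hM i j
      rw [← map_toeplitzBand, Matrix.map_apply, ← map_sub, ← ha, ← RingHom.comp_apply, hπA]
      exact isIntegral_algebraMap
    · intro c hc
      have h := (hπ _).2 (hperm c hc)
      rw [map_perm] at h
      exact h
  obtain ⟨f, hf, hf0⟩ := hint
  refine ⟨f, hf, ?_⟩
  rwa [Matrix.map_apply, ← hπA, ← Polynomial.hom_eval₂, hπ] at hf0

/-- The automorphism `X t ↦ X t + p t` of a polynomial ring, for a translation `p` whose
components are fixed by it and by `X t ↦ X t - p t`. -/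
def translateEquiv {σ R : Type*} [CommRing R] (p : σ → MvPolynomial σ R)
    (hadd : ∀ t, aeval (fun s => X s + p s) (p t) = p t)
    (hsub : ∀ t, aeval (fun s => X s - p s) (p t) = p t) :
    MvPolynomial σ R ≃ₐ[R] MvPolynomial σ R :=
  AlgEquiv.ofAlgHom (aeval fun s => X s + p s) (aeval fun s => X s - p s)
    (by ext1 t; simp [-aeval_eq_bind₁, hadd]) (by ext1 t; simp [-aeval_eq_bind₁, hsub])

theorem permanentalIdeal_height_ge (F : Type*) [Field F] {k n : ℕ} (hk : 0 < k) (hn : k ≤ n)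
    (P : Ideal (MvPolynomial (Fin k × Fin n) F)) [P.IsPrime] (hP : permanentalIdeal F k n ≤ P) :
    ((n - k + 1 : ℕ) : ℕ∞) ≤ P.height := by
  classical
  let ε : Fin (n - k + 1) → Fin k × Fin n := fun l => (⟨0, hk⟩, ⟨l.val, by omega⟩)
  have hε : Function.Injective ε := fun a b hab => by simpa [ε, Fin.ext_iff] using hab
  let G : Matrix (Fin k) (Fin n) (MvPolynomial (Fin k × Fin n) F) :=
    Matrix.of fun i j => X (i, j)
  let p : Fin k × Fin n → MvPolynomial (Fin k × Fin n) F := fun t =>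
    if t ∈ Set.range ε then 0 else toeplitzBand G t.1 t.2
  have hp0 : ∀ l, p (ε l) = 0 := fun l => if_pos ⟨l, rfl⟩
  have hp : ∀ t, p t = 0 ∨ ∃ l, p t = X (ε l) := by
    intro t
    simp only [p, toeplitzBand]
    split_ifs with h1 h2
    · exact .inl rfl
    · exact .inr ⟨⟨t.2.val - t.1.val, by omega⟩, rfl⟩
    · exact .inl rfl
  let φ := translateEquiv p
    (fun t => by rcases hp t with h | ⟨l, h⟩ <;> rw [h] <;> simp [hp0])
    (fun t => by rcases hp t with h | ⟨l, h⟩ <;> rw [h] <;> simp [hp0])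
  let η : Fin (n - k + 1) ⊕ ↥(Set.range ε)ᶜ ≃ Fin k × Fin n :=
    ((Equiv.ofInjective ε hε).sumCongr (Equiv.refl _)).trans (Equiv.Set.sumCompl _)
  let ψ := (φ.trans (renameEquiv F η.symm)).trans (sumAlgEquiv F _ _)
  let A := MvPolynomial ↥(Set.range ε)ᶜ F
  have hφX : ∀ t, φ (X t) = X t + p t := fun t => by simp [φ, translateEquiv]
  have hφp : ∀ t, φ (p t) = p t := fun t => by
    rcases hp t with h | ⟨l, h⟩
    · simp [h]
    · rw [h, hφX, hp0, add_zero]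
  have hψε : ∀ l, ψ (X (ε l)) = X l := fun l => by
    have : η.symm (ε l) = Sum.inl l := by rw [Equiv.symm_apply_eq]; simp [η]
    simp [ψ, hφX, hp0, this]
  have hψ : ∀ t (ht : t ∉ Set.range ε), ψ (X t - p t) = C (X ⟨t, ht⟩) := fun t ht => by
    have : η.symm t = Sum.inr ⟨t, ht⟩ := by rw [Equiv.symm_apply_eq]; simp [η]
    simp only [ψ, AlgEquiv.trans_apply, map_sub φ, hφX, hφp, add_sub_cancel_right]
    simp [this]
  let Q : Ideal (MvPolynomial (Fin (n - k + 1)) A) := P.comap ψ.toRingEquiv.symm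
  have hQ : Q.height = P.height := RingEquiv.height_comap ψ.toRingEquiv.symm P
  rw [← hQ]
  apply le_height_of_monic_eval₂_mem
  intro l
  let M : Matrix (Fin k) (Fin n) (MvPolynomial (Fin (n - k + 1)) A) :=
    G.map ψ.toRingEquiv.toRingHom
  have hM : ∀ i j, M i j - toeplitzBand M i j ∈ Set.range (algebraMap A _) := fun i j => by
    rw [show M i j = ψ.toRingEquiv.toRingHom (G i j) from rfl, ← map_toeplitzBand, ← map_sub]
    by_cases ht : (i, j) ∈ Set.range ε
    · obtain ⟨l, hl⟩ := ht
      simp only [ε, Prod.mk.injEq] at hl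
      obtain ⟨rfl, rfl⟩ := hl
      have : toeplitzBand G ⟨0, hk⟩ ⟨l.val, by omega⟩ = G ⟨0, hk⟩ ⟨l.val, by omega⟩ := by
        unfold toeplitzBand
        rw [if_pos ⟨by simp, by simp only; omega⟩]
        simp
      rw [this, sub_self, map_zero]
      exact ⟨0, map_zero _⟩
    · have : G i j - toeplitzBand G i j = X (i, j) - p (i, j) := by
        simp only [p, G, if_neg ht, Matrix.of_apply]
      rw [this]
      exact ⟨X ⟨_, ht⟩, (hψ _ ht).symm⟩
  have hperm : ∀ c : Fin k → Fin n, StrictMono c →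
      perm (Matrix.of fun i j => M i (c j)) ∈ Q := fun c hc => by
    have h := map_perm ψ.toRingEquiv.toRingHom (Matrix.of fun i j => G i (c j))
    change _ = perm (Matrix.of fun i j => M i (c j)) at h
    rw [← h]
    change ψ.symm (ψ _) ∈ P
    rw [ψ.symm_apply_apply]
    exact hP (Ideal.subset_span ⟨c, hc, rfl⟩)
  obtain ⟨f, hf, hfQ⟩ := exists_monic_eval₂_mem Q hn M hM hperm (ε l).1 (ε l).2
  have hMl : M (ε l).1 (ε l).2 = X l := hψε l
  rw [hMl] at hfQ
  exact ⟨f, hf, hfQ⟩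

theorem permanentalIdeal_height_le (F : Type*) [Field F] {k n : ℕ} (hk : 0 < k) :
    ∃ P : Ideal (MvPolynomial (Fin k × Fin n) F), P.IsPrime ∧ permanentalIdeal F k n ≤ P ∧
      P.height ≤ (n : ℕ∞) := by
  classical
  let s : Finset (MvPolynomial (Fin k × Fin n) F) :=
    Finset.univ.image fun j : Fin n => X (⟨0, hk⟩, j)
  have hs : Ideal.span (s : Set (MvPolynomial (Fin k × Fin n) F)) ≠ ⊤ := by
    have hle : Ideal.span (s : Set (MvPolynomial (Fin k × Fin n) F)) ≤
        RingHom.ker (constantCoeff (R := F) (σ := Fin k × Fin n)) := by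
      rw [Ideal.span_le]
      intro x hx
      simp only [s, Finset.coe_image, Set.mem_image] at hx
      obtain ⟨j, -, rfl⟩ := hx
      simp
    exact fun h => RingHom.ker_ne_top _ (top_le_iff.1 (h ▸ hle))
  obtain ⟨P, hP⟩ := Ideal.nonempty_minimalPrimes hs
  refine ⟨P, hP.1.1, le_trans ?_ hP.1.2, ?_⟩
  · rw [permanentalIdeal, Ideal.span_le]
    rintro _ ⟨c, -, rfl⟩
    refine Ideal.sum_mem _ fun σ _ => ?_
    refine Ideal.mem_of_dvd _ (Finset.dvd_prod_of_mem _ (Finset.mem_univ ⟨0, hk⟩)) ?_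
    exact Ideal.subset_span (Finset.mem_coe.2 (Finset.mem_image_of_mem _ (Finset.mem_univ _)))
  · refine (Ideal.height_le_card_of_mem_minimalPrimes_span_finset hP).trans ?_
    exact_mod_cast Finset.card_image_le.trans (by simp)

/-- For an arbitrary field `F`, `k ≥ 2` and `n ≥ k`, the height of the maximal permanental
ideal `I_{k,n}` satisfies `n - k + 1 ≤ height I_{k,n} ≤ n`: the codimension of
`P_{k,n} = {prk(M) ≤ k-1}` in `F^{k×n}` is between `n - k + 1` and `n`. -/
theorem statement3 (F : Type*) [Field F] (k n : ℕ) (hk : 2 ≤ k) (hn : k ≤ n) :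
    ((n - k + 1 : ℕ) : ℕ∞) ≤ idealHeight (permanentalIdeal F k n) ∧
      idealHeight (permanentalIdeal F k n) ≤ (n : ℕ∞) := by
  refine ⟨le_iInf₂ fun P hP => ?_, ?_⟩
  · rw [← PrimeSpectrum.height_eq_orderHeight]
    exact permanentalIdeal_height_ge F (by omega) hn P.asIdeal hP
  · obtain ⟨P, hP, hle, hheight⟩ := permanentalIdeal_height_le F (n := n) (k := k) (by omega)
    refine (iInf₂_le ⟨P, hP⟩ hle).trans ?_
    rwa [← PrimeSpectrum.height_eq_orderHeight]

end
end

section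
/- Let F be a field of characteristic zero, 2 ≤ k ≤ 5, and n ≥ k+1. Then the maximal permanental ideal I_{k,n} of the generic k×n matrix has height n; equivalently, the codimension of P_{k,n} = {prk(M) ≤ k−1} in F^{k×n} is n. -/
open MvPolynomial

noncomputable section

/-- The relative algebraic closure in `K` of the subfield generated by `S` over `F`. -/
def acl (F : Type*) [Field F] {K : Type*} [Field K] [Algebra F K] (S : Set K) :
    IntermediateField F K where
  carrier := (AlgebraicIndependent.matroid F K).closure S
  mul_mem' {a b} ha hb := by
    rw [AlgebraicIndependent.matroid_closure_eq] at *
    exact mul_mem ha hb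
  add_mem' {a b} ha hb := by
    rw [AlgebraicIndependent.matroid_closure_eq] at *
    exact add_mem ha hb
  algebraMap_mem' r := by
    rw [AlgebraicIndependent.matroid_closure_eq]
    exact isAlgebraic_algebraMap (⟨algebraMap F K r, algebraMap_mem _ r⟩ : Algebra.adjoin F S)
  inv_mem' x hx := by
    rw [AlgebraicIndependent.matroid_closure_eq] at *
    exact IsAlgebraic.inv hx

section acl

variable {F : Type*} [Field F] {K : Type*} [Field K] [Algebra F K]

theorem coe_acl (S : Set K) :
    (acl F S : Set K) = (AlgebraicIndependent.matroid F K).closure S := rfl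

theorem subset_acl (S : Set K) : S ⊆ acl F S :=
  (AlgebraicIndependent.matroid F K).subset_closure S

theorem acl_le_of_subset {S T : Set K} (h : S ⊆ acl F T) : acl F S ≤ acl F T :=
  (AlgebraicIndependent.matroid F K).closure_subset_closure_of_subset_closure h

theorem acl_mono {S T : Set K} (h : S ⊆ T) : acl F S ≤ acl F T :=
  (AlgebraicIndependent.matroid F K).closure_subset_closure h

theorem mem_acl_iff {S : Set K} {x : K} :
    x ∈ acl F S ↔ IsAlgebraic (Algebra.adjoin F S) x := by
  rw [← SetLike.mem_coe, coe_acl, AlgebraicIndependent.matroid_closure_eq]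
  rfl

theorem eRk_le_card_of_subset_acl {S : Set K} {B : Finset K} (h : S ⊆ acl F (B : Set K)) :
    (AlgebraicIndependent.matroid F K).eRk S ≤ B.card := by
  calc _ ≤ _ := Matroid.eRk_mono _ h
    _ = _ := Matroid.eRk_closure_eq _ _
    _ ≤ _ := Matroid.eRk_le_encard _ _
    _ = _ := Set.encard_coe_eq_coe_finsetCard B

end acl

theorem height_le_height_map_C {R : Type*} [CommRing R] (p : Ideal R) [p.IsPrime] :
    p.height ≤ (p.map Polynomial.C).height := by
  let f : PrimeSpectrum R → PrimeSpectrum (Polynomial R) := fun q =>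
    ⟨q.asIdeal.map Polynomial.C, Ideal.isPrime_map_C_of_isPrime⟩
  have hf : StrictMono f := by
    apply Monotone.strictMono_of_injective
    · intro a b h
      exact Ideal.map_mono h
    · intro a b h
      have h' : a.asIdeal.map Polynomial.C = b.asIdeal.map Polynomial.C :=
        congrArg PrimeSpectrum.asIdeal h
      ext x
      have := Ideal.mem_map_C_iff (I := a.asIdeal) (f := Polynomial.C x)
      have h2 := Ideal.mem_map_C_iff (I := b.asIdeal) (f := Polynomial.C x)
      rw [h', h2] at this
      constructor
      · intro hx
        simpa using this.2 (by
          intro n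
          rw [Polynomial.coeff_C]
          split_ifs <;> simp [hx]) 0
      · intro hx
        simpa using this.1 (by
          intro n
          rw [Polynomial.coeff_C]
          split_ifs <;> simp [hx]) 0
  have := Order.height_le_height_apply_of_strictMono f hf ⟨p, inferInstance⟩
  rwa [← PrimeSpectrum.height_eq_orderHeight, ← PrimeSpectrum.height_eq_orderHeight] at this

theorem le_height_ker_add_eRk {F : Type*} [Field F] {K : Type*} [Field K] [Algebra F K] (m : ℕ)
    (φ : MvPolynomial (Fin m) F →ₐ[F] K) :
    (m : ℕ∞) ≤ (RingHom.ker φ).height +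
      (AlgebraicIndependent.matroid F K).eRk (Set.range fun i => φ (X i)) := by
  induction m with
  | zero => simp
  | succ m ih =>
    let e := finSuccEquiv F m
    let ψ : Polynomial (MvPolynomial (Fin m) F) →ₐ[F] K := φ.comp e.symm.toAlgHom
    let φ' : MvPolynomial (Fin m) F →ₐ[F] K :=
      ψ.comp (Algebra.ofId (MvPolynomial (Fin m) F) (Polynomial (MvPolynomial (Fin m) F)) |>.restrictScalars F)
    have hφ' (s) : φ' s = ψ (Polynomial.C s) := rfl
    have hψ (s) : ψ (e s) = φ s := by simp [ψ]
    have hker : (RingHom.ker φ).height = (RingHom.ker ψ).height := by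
      rw [← RingEquiv.height_comap e.toRingEquiv (RingHom.ker ψ)]
      congr 1
      ext s
      simp only [Ideal.mem_comap, RingHom.mem_ker]
      rw [← hψ]; rfl
    have hrange : (Set.range fun i => φ (X i)) =
        insert (ψ Polynomial.X) (Set.range fun i => φ' (X i)) := by
      ext x
      simp only [Set.mem_range, Set.mem_insert_iff, Fin.exists_fin_succ, hφ', ← hψ, e,
        finSuccEquiv_X_zero, finSuccEquiv_X_succ, eq_comm]
    have hle : (RingHom.ker φ').map Polynomial.C ≤ RingHom.ker ψ := by
      rw [Ideal.map_le_iff_le_comap]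
      intro s hs
      exact hs
    have : (RingHom.ker φ').IsPrime := RingHom.ker_isPrime φ'
    have : (RingHom.ker ψ).IsPrime := RingHom.ker_isPrime ψ
    have : ((RingHom.ker φ').map Polynomial.C).IsPrime := Ideal.isPrime_map_C_of_isPrime
    have h1 := height_le_height_map_C (RingHom.ker φ')
    rw [hker, hrange]
    by_cases ha : ψ Polynomial.X ∈ acl F (Set.range fun i => φ' (X i))
    · have hlt : (RingHom.ker φ').map Polynomial.C < RingHom.ker ψ := by
        refine lt_of_le_of_ne hle fun heq => ?_
        rw [mem_acl_iff] at ha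
        have hadj : Algebra.adjoin F (Set.range fun i => φ' (X i)) = φ'.range := by
          rw [← Algebra.map_top, ← MvPolynomial.adjoin_range_X, AlgHom.map_adjoin]
          congr 1
          ext; simp
        rw [hadj] at ha
        obtain ⟨p, hp0, hp⟩ := ha
        obtain ⟨q, rfl⟩ := Polynomial.map_surjective φ'.rangeRestrict.toRingHom
          φ'.rangeRestrict_surjective p
        have hq : ψ q = 0 := by
          rw [← hp, Polynomial.aeval_def, Polynomial.eval₂_map]
          conv_lhs => rw [← Polynomial.eval₂_C_X (p := q)]
          rw [Polynomial.eval₂_eq_sum_range, Polynomial.eval₂_eq_sum_range]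
          simp only [map_sum, map_mul, map_pow]
          rfl
        have hq' : q ∈ (RingHom.ker φ').map Polynomial.C := by
          rw [heq]; exact hq
        rw [Ideal.mem_map_C_iff] at hq'
        apply hp0
        ext n
        simpa [Polynomial.coeff_map] using hq' n
      have h2 := Ideal.height_add_one_le_of_lt_of_isPrime hlt
      calc ((m + 1 : ℕ) : ℕ∞) = m + 1 := by simp
        _ ≤ (RingHom.ker φ').height + (AlgebraicIndependent.matroid F K).eRk
            (Set.range fun i => φ' (X i)) + 1 := by gcongr; exact ih φ'
        _ = (RingHom.ker φ').height + 1 + (AlgebraicIndependent.matroid F K).eRk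
            (Set.range fun i => φ' (X i)) := by ring
        _ ≤ _ := by
          gcongr
          · exact (by gcongr : (RingHom.ker φ').height + 1 ≤ _ + 1).trans h2
          · exact Matroid.eRk_mono _ (Set.subset_insert _ _)
    · rw [Matroid.eRk_insert_eq_add_one ⟨Set.mem_univ _, ha⟩]
      calc ((m + 1 : ℕ) : ℕ∞) = m + 1 := by simp
        _ ≤ (RingHom.ker φ').height + (AlgebraicIndependent.matroid F K).eRk
            (Set.range fun i => φ' (X i)) + 1 := by gcongr; exact ih φ'
        _ ≤ _ := by
          rw [add_assoc]
          gcongr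
          exact h1.trans (Ideal.height_mono hle)

/-- Over a field `K`, the number of variables is at most the height of the kernel of an evaluation
map plus the number of elements over which all the values of the variables are algebraic. -/
theorem card_le_height_ker_add_card {F : Type*} [Field F] {K : Type*} [Field K] [Algebra F K]
    {σ : Type*} [Fintype σ] (φ : MvPolynomial σ F →ₐ[F] K) (B : Finset K)
    (hB : ∀ i, φ (X i) ∈ acl F (B : Set K)) :
    (Fintype.card σ : ℕ∞) ≤ (RingHom.ker φ).height + B.card := by
  let e := renameEquiv F (Fintype.equivFin σ)
  have h := le_height_ker_add_eRk (Fintype.card σ) (φ.comp e.symm.toAlgHom)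
  have hker : (RingHom.ker (φ.comp e.symm.toAlgHom)).height = (RingHom.ker φ).height := by
    rw [← RingEquiv.height_comap e.symm.toRingEquiv (RingHom.ker φ)]
    rfl
  rw [hker] at h
  refine h.trans ?_
  gcongr
  apply eRk_le_card_of_subset_acl
  rintro _ ⟨i, rfl⟩
  simpa [e] using hB _

section permanent

variable {R : Type*} [CommRing R]

theorem perm_eq_permanent {m : ℕ} (A : Matrix (Fin m) (Fin m) R) :
    perm A = A.transpose.permanent := rfl

theorem perm_transpose {m : ℕ} (A : Matrix (Fin m) (Fin m) R) :
    perm A.transpose = perm A := by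
  rw [perm_eq_permanent, perm_eq_permanent, Matrix.permanent_transpose]

theorem perm_submatrix_perm_id {m : ℕ} (A : Matrix (Fin m) (Fin m) R) (ρ : Equiv.Perm (Fin m)) :
    perm (A.submatrix ρ id) = perm A := by
  rw [perm_eq_permanent, perm_eq_permanent, ← Matrix.permanent_permute_rows ρ A.transpose]
  rfl

theorem perm_submatrix_id_perm {m : ℕ} (A : Matrix (Fin m) (Fin m) R) (ρ : Equiv.Perm (Fin m)) :
    perm (A.submatrix id ρ) = perm A := by
  rw [perm_eq_permanent, perm_eq_permanent, ← Matrix.permanent_permute_cols ρ A.transpose]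
  rfl

theorem perm_map {S : Type*} [CommRing S] (φ : R →+* S) {m : ℕ} (A : Matrix (Fin m) (Fin m) R) :
    perm (A.map φ) = φ (perm A) := by
  simp [perm]

theorem perm_submatrix_eq_of_range_eq {m : ℕ} {κ : Type*} (A : Matrix (Fin m) κ R)
    {f g : Fin m → κ} (hf : f.Injective) (hg : g.Injective) (h : Set.range f = Set.range g) :
    perm (A.submatrix id f) = perm (A.submatrix id g) := by
  let ρ : Equiv.Perm (Fin m) :=
    (Equiv.ofInjective f hf).trans ((Equiv.setCongr h).trans (Equiv.ofInjective g hg).symm)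
  have hρ : f = g ∘ ρ := by
    funext i
    have := Equiv.apply_ofInjective_symm hg ((Equiv.setCongr h) (Equiv.ofInjective f hf i))
    exact this.symm
  rw [hρ, ← perm_submatrix_id_perm (A.submatrix id g) ρ]
  rfl

theorem perm_succ_row {m : ℕ} (A : Matrix (Fin (m + 1)) (Fin (m + 1)) R) :
    perm A = ∑ a, A 0 a * perm (A.submatrix Fin.succ a.succAbove) := by
  have h (a : Fin (m + 1)) : perm (A.submatrix Fin.succ a.succAbove) =
      perm (A.submatrix Fin.succ (Equiv.swap 0 a ∘ Fin.succ)) := by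
    apply perm_submatrix_eq_of_range_eq (A.submatrix Fin.succ id) Fin.succAbove_right_injective
      ((Equiv.swap 0 a).injective.comp (Fin.succ_injective m))
    rw [Set.range_comp, Fin.range_succ, Fin.range_succAbove, Set.image_compl_eq (Equiv.bijective _)]
    simp
  simp_rw [h]
  unfold perm
  rw [← Equiv.Perm.decomposeFin.symm.sum_comp, Fintype.sum_prod_type]
  refine Finset.sum_congr rfl fun a _ => ?_
  rw [Finset.mul_sum]
  refine Finset.sum_congr rfl fun σ _ => ?_
  rw [Fin.prod_univ_succ]
  simp

theorem perm_succ_col {m : ℕ} (A : Matrix (Fin (m + 1)) (Fin (m + 1)) R) :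
    perm A = ∑ i, A i 0 * perm (A.submatrix i.succAbove Fin.succ) := by
  rw [← perm_transpose, perm_succ_row]
  refine Finset.sum_congr rfl fun i _ => ?_
  rw [← perm_transpose]
  rfl

/-- All maximal permanents of `M` vanish. -/
def PermVanish {k : ℕ} {κ : Type*} (M : Matrix (Fin k) κ R) : Prop :=
  ∀ f : Fin k → κ, f.Injective → perm (M.submatrix id f) = 0

theorem permVanish_of_strictMono {k : ℕ} {n : ℕ} {M : Matrix (Fin k) (Fin n) R}
    (h : ∀ f : Fin k → Fin n, StrictMono f → perm (M.submatrix id f) = 0) : PermVanish M := by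
  intro f hf
  let s : Finset (Fin n) := Finset.univ.image f
  have hs : s.card = k := by rw [Finset.card_image_of_injective _ hf]; simp
  rw [perm_submatrix_eq_of_range_eq M hf (s.orderEmbOfFin hs).injective (by simp [s])]
  exact h _ (s.orderEmbOfFin hs).strictMono

theorem not_permVanish_of_isEmpty [Nontrivial R] {κ : Type*} (M : Matrix (Fin 0) κ R) :
    ¬ PermVanish M := by
  intro h
  have := h Fin.elim0 (fun x => x.elim0)
  simp [perm] at this

theorem PermVanish.submatrix_perm {k : ℕ} {κ : Type*} {M : Matrix (Fin k) κ R} (h : PermVanish M)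
    (ρ : Equiv.Perm (Fin k)) : PermVanish (M.submatrix ρ id) := fun f hf => by
  rw [← h f hf, ← perm_submatrix_perm_id (M.submatrix id f) ρ]
  rfl

theorem PermVanish.submatrix_injective {k : ℕ} {κ κ' : Type*} {M : Matrix (Fin k) κ R}
    (h : PermVanish M) {g : κ' → κ} (hg : g.Injective) : PermVanish (M.submatrix id g) :=
  fun f hf => h (g ∘ f) (hg.comp hf)

theorem PermVanish.scale_cols {k : ℕ} {κ : Type*} {M : Matrix (Fin k) κ R}
    (h : PermVanish M) (d : κ → R) : PermVanish (Matrix.of fun i c => M i c * d c) := by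
  intro f hf
  have : perm ((Matrix.of fun i c => M i c * d c).submatrix id f) =
      perm (M.submatrix id f) * ∏ i, d (f i) := by
    simp only [perm, Matrix.submatrix_apply, Matrix.of_apply, Finset.prod_mul_distrib,
      Finset.sum_mul]
    refine Finset.sum_congr rfl fun σ _ => ?_
    congr 1
    exact Equiv.prod_comp σ fun i => d (f i)
  rw [this, h f hf, zero_mul]

theorem PermVanish.map {S : Type*} [CommRing S] {k : ℕ} {κ : Type*}
    {M : Matrix (Fin k) κ R} (h : PermVanish M) (φ : R →+* S) : PermVanish (M.map φ) := by
  intro f hf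
  rw [Matrix.submatrix_map, perm_map, h f hf, map_zero]

theorem PermVanish.of_map {S : Type*} [CommRing S] {k : ℕ} {κ : Type*}
    {M : Matrix (Fin k) κ R} {φ : R →+* S} (hφ : Function.Injective φ)
    (h : PermVanish (M.map φ)) : PermVanish M := by
  intro f hf
  apply hφ
  rw [map_zero, ← h f hf, Matrix.submatrix_map, perm_map]

theorem PermVanish.scale_rows {k : ℕ} {κ : Type*}
    {M : Matrix (Fin k) κ R} (h : PermVanish M) (d : Fin k → R) :
    PermVanish (Matrix.of fun i c => M i c * d i) := by
  intro f hf
  have : perm ((Matrix.of fun i c => M i c * d i).submatrix id f) =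
      perm (M.submatrix id f) * ∏ i, d i := by
    simp [perm, Finset.prod_mul_distrib, Finset.sum_mul]
  rw [this, h f hf, zero_mul]

theorem PermVanish.sum_row_eq_zero {k : ℕ} {κ : Type*} {M : Matrix (Fin (k + 1)) κ R}
    (h : PermVanish M) {g : Fin k → κ} (hg : g.Injective) {c : κ} (hc : c ∉ Set.range g) :
    M 0 c * perm (M.submatrix Fin.succ g) + ∑ a : Fin k, M 0 (g a) *
      perm (M.submatrix Fin.succ ((Fin.cons c g : Fin (k + 1) → κ) ∘ a.succ.succAbove)) = 0 := by
  rw [← h (Fin.cons c g) (Fin.cons_injective_iff.2 ⟨hc, hg⟩), perm_succ_row, Fin.sum_univ_succ]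
  rfl

theorem PermVanish.sum_col_eq_zero {k : ℕ} {κ : Type*} {M : Matrix (Fin (k + 1)) κ R}
    (h : PermVanish M) {g : Fin k → κ} (hg : g.Injective) {c : κ} (hc : c ∉ Set.range g) :
    ∑ i, M i c * perm (M.submatrix i.succAbove g) = 0 := by
  rw [← h (Fin.cons c g) (Fin.cons_injective_iff.2 ⟨hc, hg⟩), perm_succ_col]
  rfl

end permanent

section symmetric

open scoped Polynomial

variable {R S : Type*} [CommRing R] [CommRing S]

/-- The generating polynomial of the elementary symmetric functions of `x`. -/
def esymmPoly {n : ℕ} (x : Fin n → R) : R[X] := ∏ c, (1 + Polynomial.C (x c) * Polynomial.X)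

theorem esymmPoly_coeff {n : ℕ} (x : Fin n → R) (b : ℕ) :
    (esymmPoly x).coeff b = ∑ T ∈ Finset.powersetCard b Finset.univ, ∏ t ∈ T, x t := by
  simp only [esymmPoly, Finset.prod_one_add, Finset.prod_mul_distrib, Finset.prod_const,
    ← map_prod, Polynomial.finsetSum_coeff, Polynomial.coeff_C_mul_X_pow]
  rw [← Finset.sum_filter]
  refine Finset.sum_congr ?_ fun _ _ => rfl
  ext T
  simp [Finset.mem_powersetCard, eq_comm]

theorem esymmPoly_map (f : R →+* S) {n : ℕ} (x : Fin n → R) :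
    (esymmPoly x).map f = esymmPoly (fun c => f (x c)) := by
  simp [esymmPoly, Polynomial.map_prod]

theorem esymmPoly_comp {n : ℕ} (x : Fin n → R) (r : R) :
    (esymmPoly x).comp (Polynomial.C r * Polynomial.X) = esymmPoly (fun c => x c * r) := by
  simp [esymmPoly, Polynomial.prod_comp, mul_assoc]

theorem esymmPoly_succAbove {n : ℕ} (x : Fin (n + 1) → R) (j : Fin (n + 1)) :
    esymmPoly x = esymmPoly (x ∘ j.succAbove) * (1 + Polynomial.C (x j) * Polynomial.X) := by
  rw [esymmPoly, Fin.prod_univ_succAbove _ j, mul_comm]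
  rfl

theorem esymmPoly_perm {n : ℕ} (x : Fin n → R) (σ : Equiv.Perm (Fin n)) :
    esymmPoly (x ∘ σ) = esymmPoly x :=
  Equiv.prod_comp σ fun c => 1 + Polynomial.C (x c) * Polynomial.X

theorem eq_zero_of_esymmPoly_eq_one {κ : Type*} [Field κ] {n : ℕ} {y : Fin n → κ}
    (h : esymmPoly y = 1) (i : Fin n) : y i = 0 := by
  by_contra hi
  have := congrArg (Polynomial.eval (-(y i)⁻¹)) h
  rw [esymmPoly, Polynomial.eval_prod, Finset.prod_eq_zero (Finset.mem_univ i) (by simp [hi])] at this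
  simp at this

/-- The generating polynomial of the elementary symmetric functions of the row shifts, weighted
by the number of permutations mapping one set of given size onto another. -/
def weightedPoly {k : ℕ} (y : Fin k → R) : R[X] :=
  ∑ m ∈ Finset.range (k + 1),
    Polynomial.C (((k - m).factorial * (m + 1).factorial : ℕ) * (esymmPoly y).coeff m) * Polynomial.X ^ m

theorem weightedPoly_coeff {k : ℕ} (y : Fin k → R) {m : ℕ} (hm : m ≤ k) :
    (weightedPoly y).coeff m =
      ((k - m).factorial * (m + 1).factorial : ℕ) * (esymmPoly y).coeff m := by
  simp only [weightedPoly, Polynomial.finsetSum_coeff, Polynomial.coeff_C_mul_X_pow]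
  rw [Finset.sum_ite_eq, if_pos (by simpa using Nat.lt_succ_of_le hm)]

theorem weightedPoly_map (f : R →+* S) {k : ℕ} (y : Fin k → R) :
    (weightedPoly y).map f = weightedPoly (fun i => f (y i)) := by
  simp [weightedPoly, Polynomial.map_sum, ← esymmPoly_map]

theorem weightedPoly_comp {k : ℕ} (y : Fin k → R) (r : R) :
    (weightedPoly y).comp (Polynomial.C r * Polynomial.X) = weightedPoly (fun i => y i * r) := by
  rw [weightedPoly, ← Polynomial.coe_compRingHom_apply, map_sum]
  simp only [weightedPoly, Polynomial.coe_compRingHom_apply, ← esymmPoly_comp, Polynomial.comp_C_mul_X_coeff]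
  refine Finset.sum_congr rfl fun m _ => ?_
  simp
  ring

theorem weightedPoly_mul_coeff_scale {k n : ℕ} (y : Fin k → R) (x : Fin n → R) (r : R) (t : ℕ) :
    (weightedPoly (fun i => y i * r) * esymmPoly (fun c => x c * r)).coeff t =
      (weightedPoly y * esymmPoly x).coeff t * r ^ t := by
  rw [← weightedPoly_comp, ← esymmPoly_comp, ← Polynomial.mul_comp, Polynomial.comp_C_mul_X_coeff]

variable {κ : Type*} [Field κ] [CharZero κ]

theorem sum_perm_prod_eq {m : ℕ} (x : Fin m → κ) (B : Finset (Fin m)) :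
    ∑ σ : Equiv.Perm (Fin m), ∏ i ∈ B, x (σ i) =
      (B.card.factorial * (m - B.card).factorial : ℕ) * (esymmPoly x).coeff B.card := by
  have hBm : B.card ≤ m := by simpa using Finset.card_le_univ B
  have hinv (B' : Finset (Fin m)) (hB' : B'.card = B.card) :
      ∑ σ : Equiv.Perm (Fin m), ∏ i ∈ B', x (σ i) = ∑ σ : Equiv.Perm (Fin m), ∏ i ∈ B, x (σ i) := by
    let ρ : Equiv.Perm (Fin m) := (Finset.equivOfCardEq hB').extendSubtype
    have hρ : B'.map ρ.toEmbedding = B := by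
      refine Finset.eq_of_subset_of_card_le (fun b hb => ?_) (by simp [hB'])
      obtain ⟨a, ha, rfl⟩ := Finset.mem_map.1 hb
      exact Equiv.extendSubtype_mem _ a ha
    rw [← Equiv.sum_comp (Equiv.mulRight ρ)]
    refine Finset.sum_congr rfl fun σ _ => ?_
    rw [← hρ, Finset.prod_map]
    rfl
  have hsum : (m.choose B.card : κ) * ∑ σ : Equiv.Perm (Fin m), ∏ i ∈ B, x (σ i) =
      m.factorial * (esymmPoly x).coeff B.card := by
    calc _ = ∑ B' ∈ Finset.powersetCard B.card (Finset.univ : Finset (Fin m)),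
          ∑ σ : Equiv.Perm (Fin m), ∏ i ∈ B', x (σ i) := by
          rw [Finset.sum_congr rfl fun B' hB' => hinv B' (Finset.mem_powersetCard.1 hB').2]
          simp
      _ = ∑ σ : Equiv.Perm (Fin m), (esymmPoly x).coeff B.card := by
          rw [Finset.sum_comm]
          refine Finset.sum_congr rfl fun σ _ => ?_
          rw [← esymmPoly_perm x σ, esymmPoly_coeff]
          rfl
      _ = _ := by simp [Fintype.card_perm]
  have hne : (m.choose B.card : κ) ≠ 0 := by
    exact_mod_cast (Nat.choose_pos hBm).ne'
  apply mul_left_cancel₀ hne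
  rw [hsum, ← Nat.choose_mul_factorial_mul_factorial hBm]
  push_cast
  ring

theorem perm_cons_one_add {k : ℕ} (x : Fin (k + 1) → κ) (y : Fin k → κ) :
    perm (Matrix.of (Fin.cons (fun _ => 1) (fun i c => x c + y i) :
      Fin (k + 1) → Fin (k + 1) → κ)) = (weightedPoly y * esymmPoly x).coeff k := by
  have hB (B : Finset (Fin k)) :
      ∑ σ : Equiv.Perm (Fin (k + 1)), ∏ i ∈ Finset.univ \ B, x (σ i.succ) =
        ((k - B.card).factorial * (B.card + 1).factorial : ℕ) *
          (esymmPoly x).coeff (k - B.card) := by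
    have := sum_perm_prod_eq x ((Finset.univ \ B).map (Fin.succEmb k))
    have hBk : B.card ≤ k := by simpa using Finset.card_le_univ B
    rw [Finset.card_map, ← Finset.compl_eq_univ_sdiff, Finset.card_compl, Fintype.card_fin,
      show k + 1 - (k - B.card) = B.card + 1 by omega] at this
    rw [← this]
    simp [Finset.prod_map, ← Finset.compl_eq_univ_sdiff]
  simp only [perm, Fin.prod_univ_succ, Matrix.of_apply, Fin.cons_zero, Fin.cons_succ, one_mul,
    add_comm (x _), Finset.prod_add]
  rw [Finset.sum_comm]
  simp only [← Finset.mul_sum, hB]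
  rw [Finset.sum_powerset, Polynomial.coeff_mul, Finset.Nat.sum_antidiagonal_eq_sum_range_succ_mk]
  simp only [Finset.card_univ, Fintype.card_fin]
  refine Finset.sum_congr rfl fun m hm => ?_
  rw [weightedPoly_coeff y (by simpa [Nat.lt_succ_iff] using hm), esymmPoly_coeff y,
    Finset.mul_sum, Finset.sum_mul]
  refine Finset.sum_congr rfl fun B hB => ?_
  rw [(Finset.mem_powersetCard.1 hB).2]
  ring

theorem eq_zero_of_permVanish_cons_one_add {k : ℕ} {x : Fin (k + 3) → κ} {y : Fin (k + 1) → κ}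
    (hx : x 0 = 0)
    (hP : PermVanish (Matrix.of (Fin.cons (fun _ => 1) (fun i c => x c + y i) :
      Fin (k + 2) → Fin (k + 3) → κ)))
    (hH : ∀ t < k, (weightedPoly y * esymmPoly x).coeff (t + 1) = 0) :
    (∀ c, x c = 0) ∧ ∀ i, y i = 0 := by
  have hcoeff (j : Fin (k + 3)) :
      (weightedPoly y * esymmPoly (x ∘ j.succAbove)).coeff (k + 1) = 0 := by
    rw [← perm_cons_one_add, ← hP j.succAbove Fin.succAbove_right_injective]
    congr 1
    ext i c
    refine Fin.cases ?_ (fun i => ?_) i <;> rfl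
  have hH' : ∀ t < k + 1, (weightedPoly y * esymmPoly x).coeff (t + 1) = 0 := by
    intro t ht
    rcases Nat.lt_succ_iff_lt_or_eq.1 ht with h | rfl
    · exact hH t h
    · rw [esymmPoly_succAbove x 0, hx]
      simpa using hcoeff 0
  have h0 : (weightedPoly y).coeff 0 ≠ 0 := by
    rw [weightedPoly_coeff y (Nat.zero_le _), esymmPoly_coeff]
    simp [Nat.factorial_ne_zero]
  have hxz (j) : x j = 0 := by
    have hpow : ∀ t ≤ k + 1, (weightedPoly y * esymmPoly (x ∘ j.succAbove)).coeff t =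
        (weightedPoly y).coeff 0 * (-x j) ^ t := by
      intro t ht
      induction t with
      | zero => simp [Polynomial.mul_coeff_zero, esymmPoly_coeff]
      | succ t ih =>
        have := hH' t ht
        rw [esymmPoly_succAbove x j, ← mul_assoc, mul_add, mul_one, Polynomial.coeff_add, ← mul_assoc,
          Polynomial.coeff_mul_X, Polynomial.coeff_mul_C, ih (by omega)] at this
        rw [eq_neg_of_add_eq_zero_left this]
        ring
    have := hpow (k + 1) le_rfl
    rw [hcoeff, eq_comm, mul_eq_zero, or_iff_right h0] at this
    simpa using eq_zero_of_pow_eq_zero this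
  refine ⟨hxz, eq_zero_of_esymmPoly_eq_one ?_⟩
  have hx1 : esymmPoly x = 1 := by simp [esymmPoly, hxz]
  rw [hx1, mul_one] at hH'
  ext m
  rcases m with _ | m
  · simp [esymmPoly_coeff]
  · rw [Polynomial.coeff_one, if_neg (by omega)]
    by_cases hm : m < k + 1
    · have := hH' m hm
      rw [weightedPoly_coeff y hm] at this
      simpa [Nat.factorial_ne_zero, Nat.cast_add_one_ne_zero] using this
    · rw [esymmPoly_coeff, Finset.powersetCard_eq_empty.2 (by simp; omega)]
      simp

end symmetric

section normalized

variable {F : Type*} [Field F] {K : Type*} [Field K] [Algebra F K]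

theorem exists_valuationSubring_of_notMem_acl {S : Set K} {x : K} (hx : x ∉ acl F S) :
    ∃ V : ValuationSubring K, (∀ z ∈ acl F S, z ∈ V) ∧ x ∉ V := by
  have : IsIntegrallyClosedIn (acl F S).toSubring K := by
    rw [isIntegrallyClosedIn_iff]
    refine ⟨Subtype.val_injective, fun {z} hz => ?_⟩
    have hz' : z ∈ acl F (acl F S : Set K) := by
      rw [mem_acl_iff]
      have hadj : Algebra.adjoin F (acl F S : Set K) = (acl F S).toSubalgebra :=
        Algebra.adjoin_eq _
      rw [hadj]
      exact (show IsIntegral (acl F S).toSubalgebra z from hz).isAlgebraic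
    exact ⟨⟨z, acl_le_of_subset subset_rfl hz'⟩, rfl⟩
  obtain ⟨V, hV, hxV⟩ := Subring.exists_le_valuationSubring_of_isIntegrallyClosedIn
    (R := (acl F S).toSubring) hx
  exact ⟨V, fun z hz => hV hz, hxV⟩

/-- The forms of the entries of a matrix whose common zeros on the permanental variety,
normalized by a row of ones, are trivial. -/
def systemOfParameters [DecidableEq K] {k : ℕ} (N : Matrix (Fin (k + 1)) (Fin (k + 3)) K) :
    Finset K :=
  (Finset.univ : Finset (Fin k × Fin (k + 2))).image
      (fun p => N p.1.succ p.2.succ - N p.1.succ 0 - N 0 p.2.succ + N 0 0) ∪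
    (Finset.univ : Finset (Fin k)).image (fun t : Fin k =>
      (weightedPoly (fun i => N i 0) * esymmPoly (fun c => N 0 c - N 0 0)).coeff ((t : ℕ) + 1))

theorem mem_acl_systemOfParameters [CharZero F] [DecidableEq K] {k : ℕ}
    {N : Matrix (Fin (k + 1)) (Fin (k + 3)) K}
    (hN : PermVanish (Matrix.of (Fin.cons (fun _ => 1) N : Fin (k + 2) → Fin (k + 3) → K)))
    (i : Fin (k + 1)) (c : Fin (k + 3)) :
    N i c ∈ acl F (systemOfParameters N : Set K) := by
  by_contra hic
  obtain ⟨V, hV, hicV⟩ := exists_valuationSubring_of_notMem_acl hic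
  obtain ⟨⟨i₁, c₁⟩, -, hmax⟩ := Finset.exists_max_image
    (Finset.univ : Finset (Fin (k + 1) × Fin (k + 3))) (fun p => V.valuation (N p.1 p.2))
    ⟨(i, c), Finset.mem_univ _⟩
  have hpV : N i₁ c₁ ∉ V := by
    rw [← V.valuation_le_one_iff] at hicV ⊢
    exact fun h => hicV ((hmax (i, c) (Finset.mem_univ _)).trans h)
  have hp0 : N i₁ c₁ ≠ 0 := fun h => hpV (h ▸ zero_mem V)
  let w : V := ⟨(N i₁ c₁)⁻¹, (V.mem_or_inv_mem _).resolve_left hpV⟩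
  let π := IsLocalRing.residue V
  have hw : π w = 0 := by
    rw [IsLocalRing.residue_eq_zero_iff, IsLocalRing.mem_maximalIdeal, mem_nonunits_iff]
    rintro ⟨u, hu⟩
    apply hpV
    have h1 : ((u⁻¹ : Vˣ) : V) * w = 1 := by rw [← hu, Units.inv_mul]
    have h2 : (((u⁻¹ : Vˣ) : V) : K) * (N i₁ c₁)⁻¹ = 1 := congrArg Subtype.val h1
    rw [← div_eq_mul_inv, div_eq_one_iff_eq hp0] at h2
    exact h2 ▸ Subtype.property _
  have hmem (i c) : N i c * (N i₁ c₁)⁻¹ ∈ V := by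
    rw [← V.valuation_le_one_iff, map_mul, map_inv₀, ← div_eq_mul_inv]
    exact div_le_one_of_le₀ (hmax (i, c) (Finset.mem_univ _)) zero_le
  let N' : Matrix (Fin (k + 1)) (Fin (k + 3)) V := fun i c => ⟨N i c * (N i₁ c₁)⁻¹, hmem i c⟩
  have hN' : PermVanish (Matrix.of (Fin.cons (fun _ => 1) N' : Fin (k + 2) → Fin (k + 3) → V)) := by
    refine PermVanish.of_map (φ := V.subtype) Subtype.val_injective ?_
    convert hN.scale_rows (Fin.cons 1 fun _ => (N i₁ c₁)⁻¹) using 1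
    ext i c
    refine Fin.cases ?_ (fun i => ?_) i
    · exact (mul_one (1 : K)).symm
    · rfl
  have hsys (z) (hz : z ∈ systemOfParameters N) : z ∈ V := hV z (subset_acl _ hz)
  have hlin (i c) : π (N' i c) = (π (N' 0 c) - π (N' 0 0)) + π (N' i 0) := by
    refine Fin.cases (by ring) (fun i => ?_) i
    refine Fin.cases (by ring) (fun c => ?_) c
    have hl := hsys (N i.succ c.succ - N i.succ 0 - N 0 c.succ + N 0 0)
      (Finset.mem_union_left _ (Finset.mem_image.2 ⟨(i, c), Finset.mem_univ _, rfl⟩))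
    have heq : N' i.succ c.succ = N' 0 c.succ - N' 0 0 + N' i.succ 0 + ⟨_, hl⟩ * w := by
      apply Subtype.ext
      simp [N', w]
      ring
    rw [heq]
    simp [hw]
  have hH (t) (ht : t < k) : (weightedPoly (fun i => π (N' i 0)) *
      esymmPoly (fun c => π (N' 0 c) - π (N' 0 0))).coeff (t + 1) = 0 := by
    have hl := hsys _
      (Finset.mem_union_right _ (Finset.mem_image.2 ⟨⟨t, ht⟩, Finset.mem_univ _, rfl⟩))
    have heq : (weightedPoly (fun i => N' i 0) *
        esymmPoly (fun c => N' 0 c - N' 0 0)).coeff (t + 1) = ⟨_, hl⟩ * w ^ (t + 1) := by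
      apply V.subtype_injective
      rw [← Polynomial.coeff_map, Polynomial.map_mul, weightedPoly_map, esymmPoly_map]
      have := weightedPoly_mul_coeff_scale (fun i => N i 0) (fun c => N 0 c - N 0 0)
        (N i₁ c₁)⁻¹ (t + 1)
      simpa [N', w, sub_mul] using this
    have := congrArg π heq
    rw [← Polynomial.coeff_map, Polynomial.map_mul, weightedPoly_map, esymmPoly_map, map_mul,
      map_pow, hw] at this
    simpa using this
  let ι : F →+* V := (algebraMap F K).codRestrict V.toSubring fun r =>
    hV _ ((acl F _).algebraMap_mem r)
  have : CharZero (IsLocalRing.ResidueField V) :=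
    charZero_of_injective_ringHom (f := π.comp ι) (RingHom.injective _)
  have hmap : (Matrix.of (Fin.cons (fun _ => 1) N' : Fin (k + 2) → Fin (k + 3) → V)).map π =
      Matrix.of (Fin.cons (fun _ => 1) fun i c => π (N' 0 c) - π (N' 0 0) + π (N' i 0) :
        Fin (k + 2) → Fin (k + 3) → IsLocalRing.ResidueField V) := by
    ext i c
    exact Fin.cases (map_one π) (fun i => hlin i c) i
  have hres := eq_zero_of_permVanish_cons_one_add (x := fun c => π (N' 0 c) - π (N' 0 0))
    (y := fun i => π (N' i 0)) (sub_self _) (hmap ▸ hN'.map π) hH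
  have h1 : N' i₁ c₁ = 1 := Subtype.ext (mul_inv_cancel₀ hp0)
  have := hlin i₁ c₁
  rw [h1, map_one, hres.1, hres.2, add_zero] at this
  exact one_ne_zero this

theorem card_systemOfParameters_le [DecidableEq K] {k : ℕ}
    (N : Matrix (Fin (k + 1)) (Fin (k + 3)) K) : (systemOfParameters N).card ≤ k * (k + 3) := by
  calc _ ≤ _ := Finset.card_union_le _ _
    _ ≤ k * (k + 2) + k :=
      add_le_add (Finset.card_image_le.trans_eq (by simp)) (Finset.card_image_le.trans_eq (by simp))
    _ = _ := by ring

end normalized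

section dimension

variable {F : Type*} [Field F] {K : Type*} [Field K] [Algebra F K]

theorem perm_mem {L : IntermediateField F K} {m : ℕ} {A : Matrix (Fin m) (Fin m) K}
    (h : ∀ i j, A i j ∈ L) : perm A ∈ L :=
  sum_mem fun _ _ => prod_mem fun _ _ => h _ _

/-- A maximal permanent, nonzero on all rows but the first, makes an entry of the first row
rational over the remaining entries. -/
theorem PermVanish.apply_zero_mem {L : IntermediateField F K} {k : ℕ} {κ : Type*}
    {M : Matrix (Fin (k + 1)) κ K} (h : PermVanish M) {g : Fin k → κ} (hg : g.Injective)
    {c : κ} (hc : c ∉ Set.range g) (hne : perm (M.submatrix Fin.succ g) ≠ 0)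
    (hL : ∀ i c, M (Fin.succ i) c ∈ L) (hL0 : ∀ c', c' ≠ c → M 0 c' ∈ L) : M 0 c ∈ L := by
  have hrel := h.sum_row_eq_zero hg hc
  rw [← eq_neg_iff_add_eq_zero] at hrel
  rw [← mul_div_cancel_right₀ (M 0 c) hne, hrel]
  refine div_mem (neg_mem (sum_mem fun a _ => mul_mem (hL0 _ ?_) (perm_mem fun _ _ => hL _ _)))
    (perm_mem fun _ _ => hL _ _)
  rintro rfl
  exact hc ⟨a, rfl⟩

theorem PermVanish.apply_mem_of_col {L : IntermediateField F K} {k : ℕ} {κ : Type*}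
    {M : Matrix (Fin (k + 1)) κ K} (h : PermVanish M) {g : Fin k → κ} (hg : g.Injective)
    {c : κ} (hc : c ∉ Set.range g) {i : Fin (k + 1)} (hne : perm (M.submatrix i.succAbove g) ≠ 0)
    (hL : ∀ i c', c' ≠ c → M i c' ∈ L) (hLc : ∀ i', i' ≠ i → M i' c ∈ L) : M i c ∈ L := by
  have hrel := h.sum_col_eq_zero hg hc
  rw [← Finset.add_sum_erase _ _ (Finset.mem_univ i), ← eq_neg_iff_add_eq_zero] at hrel
  rw [← mul_div_cancel_right₀ (M i c) hne, hrel]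
  have hmem (i') : perm (M.submatrix (Fin.succAbove i') g) ∈ L :=
    perm_mem fun _ _ => hL _ _ fun hgc => hc ⟨_, hgc⟩
  exact div_mem (neg_mem (sum_mem fun i' hi' =>
    mul_mem (hLc _ (Finset.ne_of_mem_erase hi')) (hmem i'))) (hmem i)

variable (F) in
/-- The dimension bound for matrices whose maximal permanents vanish. -/
def PermBound (K : Type*) [Field K] [Algebra F K] (k n : ℕ) : Prop :=
  ∀ M : Matrix (Fin k) (Fin n) K, PermVanish M →
    ∃ B : Finset K, B.card + n ≤ k * n ∧ ∀ i c, M i c ∈ acl F (B : Set K)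

variable (F) in
/-- The dimension bound for matrices whose submaximal permanents vanish. -/
def SubpermBound (K : Type*) [Field K] [Algebra F K] (k n : ℕ) : Prop :=
  ∀ M : Matrix (Fin (k + 1)) (Fin n) K, (∀ i, PermVanish (M.submatrix (Fin.succAbove i) id)) →
    ∃ B : Finset K, B.card + n + 1 ≤ (k + 1) * n ∧ ∀ i c, M i c ∈ acl F (B : Set K)

theorem exists_notMem_range {k n : ℕ} (h : k < n) (g : Fin k → Fin n) :
    ∃ c, c ∉ Set.range g := by
  by_contra! hc
  have := Fintype.card_le_of_surjective g hc
  simp at this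
  omega

theorem exists_ne_notMem_range {k n : ℕ} (h : k + 1 < n) (g : Fin k → Fin n) (z : Fin n) :
    ∃ c, c ≠ z ∧ c ∉ Set.range g := by
  obtain ⟨c, hc⟩ := exists_notMem_range h (Fin.cons z g : Fin (k + 1) → Fin n)
  rw [Fin.range_cons, Set.mem_insert_iff, not_or] at hc
  exact ⟨c, hc⟩

theorem subpermBound_zero (n : ℕ) : SubpermBound F K 0 n :=
  fun _ h => absurd (h 0) (not_permVanish_of_isEmpty _)

theorem permBound_zero (n : ℕ) : PermBound F K 0 n :=
  fun _ h => absurd h (not_permVanish_of_isEmpty _)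

theorem permBound_one (n : ℕ) : PermBound F K 1 n := by
  intro M h
  refine ⟨∅, by simp, fun i c => ?_⟩
  have := h (fun _ => c) (Function.injective_of_subsingleton _)
  simp only [perm, Finset.univ_unique, Finset.prod_singleton, Finset.sum_singleton] at this
  obtain rfl := Subsingleton.elim i default
  simp only [Matrix.submatrix_apply, id] at this
  rw [this]
  exact zero_mem _

theorem SubpermBound.succ [DecidableEq K] {k n : ℕ} (hn : k + 1 ≤ n) (hT : PermBound F K (k + 1) n)
    (hC : SubpermBound F K k n) : SubpermBound F K (k + 1) n := by
  intro M hM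
  let N := M.submatrix Fin.succ id
  have hN : PermVanish N := hM 0
  by_cases hv : ∀ j, PermVanish (N.submatrix (Fin.succAbove j) id)
  · obtain ⟨B, hB, hNB⟩ := hC N hv
    refine ⟨B ∪ Finset.univ.image (M 0), ?_, fun i => Fin.cases (fun c => ?_) (fun i c => ?_) i⟩
    · have h1 := Finset.card_union_le B (Finset.univ.image (M 0))
      have h2 : (Finset.univ.image (M 0)).card ≤ n := Finset.card_image_le.trans_eq (by simp)
      linarith
    · exact subset_acl _ (by simp)
    · exact acl_mono (by simp) (hNB i c)
  · simp only [PermVanish, not_forall] at hv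
    obtain ⟨j, g, hg, hne⟩ := hv
    obtain ⟨B, hB, hNB⟩ := hT N hN
    obtain ⟨c, hc⟩ := exists_notMem_range hn g
    have hmem (i c') : M (Fin.succ i) c' ∈ acl F
        ((B ∪ (Finset.univ.erase c).image (M 0) : Finset K) : Set K) :=
      acl_mono (by simp) (hNB i c')
    have hmem0 (c') (hc' : c' ≠ c) : M 0 c' ∈ acl F
        ((B ∪ (Finset.univ.erase c).image (M 0) : Finset K) : Set K) := by
      refine subset_acl _ ?_
      simp only [Finset.coe_union, Set.mem_union, Finset.mem_coe, Finset.mem_image]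
      exact Or.inr ⟨c', by simp [hc'], rfl⟩
    refine ⟨B ∪ (Finset.univ.erase c).image (M 0), ?_,
      fun i => Fin.cases (fun c' => ?_) (fun i c => hmem i c) i⟩
    · have h1 := Finset.card_union_le B ((Finset.univ.erase c).image (M 0))
      have h2 : ((Finset.univ.erase c).image (M 0)).card ≤ n - 1 :=
        Finset.card_image_le.trans_eq (by simp)
      have h3 : n - 1 + 1 = n := by omega
      linarith
    · by_cases hcc : c' = c
      · subst hcc
        refine (hM j.succ).apply_zero_mem hg hc ?_ (fun i c => ?_) hmem0
        · convert hne using 2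
          ext a b
          simp [N]
        · simpa using hmem _ c
      · exact hmem0 c' hcc

theorem PermBound.succ [DecidableEq K] {k n : ℕ} (hT : PermBound F K (k + 1) n)
    (hC : SubpermBound F K k n) : PermBound F K (k + 1) (n + 1) := by
  intro M hM
  let N := M.submatrix id Fin.succ
  have hN : PermVanish N := hM.submatrix_injective (Fin.succ_injective _)
  by_cases hv : ∀ j, PermVanish (N.submatrix (Fin.succAbove j) id)
  · obtain ⟨B, hB, hNB⟩ := hC N hv
    refine ⟨B ∪ Finset.univ.image fun i => M i 0, ?_,
      fun i c => Fin.cases ?_ (fun c => ?_) c⟩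
    · have h1 := Finset.card_union_le B (Finset.univ.image fun i => M i 0)
      have h2 : (Finset.univ.image fun i => M i 0).card ≤ k + 1 :=
        Finset.card_image_le.trans_eq (by simp)
      linarith
    · exact subset_acl _ (by simp)
    · exact acl_mono (by simp) (hNB i c)
  · simp only [PermVanish, not_forall] at hv
    obtain ⟨j, g, hg, hne⟩ := hv
    obtain ⟨B, hB, hNB⟩ := hT N hN
    have hmem (i c') : M i (Fin.succ c') ∈ acl F
        ((B ∪ (Finset.univ.erase j).image (fun i => M i 0) : Finset K) : Set K) :=
      acl_mono (by simp) (hNB i c')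
    have hmem0 (i) (hi : i ≠ j) : M i 0 ∈ acl F
        ((B ∪ (Finset.univ.erase j).image (fun i => M i 0) : Finset K) : Set K) := by
      refine subset_acl _ ?_
      simp only [Finset.coe_union, Set.mem_union, Finset.mem_coe, Finset.mem_image]
      exact Or.inr ⟨i, by simp [hi], rfl⟩
    refine ⟨B ∪ (Finset.univ.erase j).image (fun i => M i 0), ?_,
      fun i c => Fin.cases ?_ (fun c => hmem i c) c⟩
    · have h1 := Finset.card_union_le B ((Finset.univ.erase j).image (fun i => M i 0))
      have h2 : ((Finset.univ.erase j).image (fun i => M i 0)).card ≤ k :=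
        Finset.card_image_le.trans_eq (by simp)
      linarith
    · by_cases hij : i = j
      · subst hij
        refine hM.apply_mem_of_col ((Fin.succ_injective _).comp hg) ?_ hne (fun i' c' hc' => ?_)
          hmem0
        · rintro ⟨a, ha⟩
          exact Fin.succ_ne_zero _ ha
        · obtain ⟨c', rfl⟩ := Fin.exists_succ_eq.2 hc'
          exact hmem _ _
      · exact hmem0 i hij

theorem permBound_add_one_of_ne_zero [DecidableEq K] {k : ℕ}
    (hE : ∀ N : Matrix (Fin (k + 1)) (Fin (k + 3)) K,
      PermVanish (Matrix.of (Fin.cons (fun _ => 1) N : Fin (k + 2) → Fin (k + 3) → K)) →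
      ∃ B : Finset K, B.card ≤ k * (k + 3) ∧ ∀ i c, N i c ∈ acl F (B : Set K))
    {M : Matrix (Fin (k + 2)) (Fin (k + 3)) K} (hM : PermVanish M) {i₀ : Fin (k + 2)}
    (hi₀ : ∀ c, M i₀ c ≠ 0) :
    ∃ B : Finset K, B.card + (k + 3) ≤ (k + 2) * (k + 3) ∧ ∀ i c, M i c ∈ acl F (B : Set K) := by
  let M' : Matrix (Fin (k + 2)) (Fin (k + 3)) K :=
    Matrix.of fun i c => M (Equiv.swap 0 i₀ i) c * (M i₀ c)⁻¹
  have hM' : PermVanish M' :=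
    (hM.submatrix_perm (Equiv.swap 0 i₀)).scale_cols fun c => (M i₀ c)⁻¹
  have hcons : M' = Matrix.of (Fin.cons (fun _ => 1) (M'.submatrix Fin.succ id) :
      Fin (k + 2) → Fin (k + 3) → K) := by
    ext i c
    refine Fin.cases ?_ (fun i => ?_) i
    · exact (by simp [M', hi₀ c] : M' 0 c = 1)
    · rfl
  rw [hcons] at hM'
  obtain ⟨B, hB, hNB⟩ := hE _ hM'
  refine ⟨B ∪ Finset.univ.image (M i₀), ?_, fun i c => ?_⟩
  · have h1 := Finset.card_union_le B (Finset.univ.image (M i₀))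
    have h2 : (Finset.univ.image (M i₀)).card ≤ k + 3 := Finset.card_image_le.trans_eq (by simp)
    linarith
  · have h0 : M i₀ c ∈ acl F ((B ∪ Finset.univ.image (M i₀) : Finset K) : Set K) :=
      subset_acl _ (by simp)
    obtain ⟨i, rfl⟩ := (Equiv.swap 0 i₀).surjective i
    refine Fin.cases ?_ (fun i => ?_) i
    · simpa using h0
    · have := mul_mem (acl_mono (by simp) (hNB i c)) h0
      simpa [M', hi₀ c] using this

theorem permBound_add_one_of_eq_zero [DecidableEq K] {k : ℕ} (hT : PermBound F K (k + 1) (k + 3))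
    {M : Matrix (Fin (k + 2)) (Fin (k + 3)) K} (hM : PermVanish M)
    (hz : ∀ i, ∃ c, M i c = 0) :
    ∃ B : Finset K, B.card + (k + 3) ≤ (k + 2) * (k + 3) ∧ ∀ i c, M i c ∈ acl F (B : Set K) := by
  let N := M.submatrix Fin.succ id
  by_cases hv : PermVanish N
  · obtain ⟨B, hB, hNB⟩ := hT N hv
    refine ⟨B ∪ Finset.univ.image (M 0), ?_, fun i => Fin.cases (fun c => ?_) (fun i c => ?_) i⟩
    · have h1 := Finset.card_union_le B (Finset.univ.image (M 0))
      have h2 : (Finset.univ.image (M 0)).card ≤ k + 3 := Finset.card_image_le.trans_eq (by simp)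
      linarith
    · exact subset_acl _ (by simp)
    · exact acl_mono (by simp) (hNB i c)
  · simp only [PermVanish, not_forall] at hv
    obtain ⟨g, hg, hne⟩ := hv
    choose z hz using hz
    obtain ⟨c, hcz, hc⟩ := exists_ne_notMem_range (by omega) g (z 0)
    let B₁ : Finset K := (Finset.univ : Finset (Fin (k + 1) × Fin (k + 2))).image
      fun p => N p.1 ((z p.1.succ).succAbove p.2)
    let B₂ : Finset K := ((Finset.univ.erase c).erase (z 0)).image (M 0)
    have hmem (i c') : M (Fin.succ i) c' ∈ acl F ((B₁ ∪ B₂ : Finset K) : Set K) := by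
      by_cases h : c' = z i.succ
      · rw [h, hz]
        exact zero_mem _
      · obtain ⟨b, rfl⟩ := Fin.exists_succAbove_eq h
        refine subset_acl _ ?_
        rw [Finset.mem_coe]
        exact Finset.mem_union_left _ (Finset.mem_image.2 ⟨(i, b), Finset.mem_univ _, rfl⟩)
    have hmem0 (c') (hc' : c' ≠ c) : M 0 c' ∈ acl F ((B₁ ∪ B₂ : Finset K) : Set K) := by
      by_cases h : c' = z 0
      · rw [h, hz]
        exact zero_mem _
      · refine subset_acl _ ?_
        rw [Finset.mem_coe]
        exact Finset.mem_union_right _ (Finset.mem_image.2 ⟨c', by simp [hc', h], rfl⟩)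
    refine ⟨B₁ ∪ B₂, ?_, fun i => Fin.cases (fun c' => ?_) (fun i c => hmem i c) i⟩
    · have h1 := Finset.card_union_le B₁ B₂
      have h2 : B₁.card ≤ (k + 1) * (k + 2) := Finset.card_image_le.trans_eq (by simp)
      have h3 : B₂.card ≤ k + 1 := by
        refine Finset.card_image_le.trans_eq ?_
        rw [Finset.card_erase_of_mem (by simp [hcz.symm]), Finset.card_erase_of_mem (by simp)]
        simp
      linarith
    · by_cases hcc : c' = c
      · subst hcc
        exact hM.apply_zero_mem hg hc hne hmem hmem0
      · exact hmem0 c' hcc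

theorem permBound_of_normalized
    (hE : ∀ (k : ℕ) (N : Matrix (Fin (k + 1)) (Fin (k + 3)) K),
      PermVanish (Matrix.of (Fin.cons (fun _ => 1) N : Fin (k + 2) → Fin (k + 3) → K)) →
      ∃ B : Finset K, B.card ≤ k * (k + 3) ∧ ∀ i c, N i c ∈ acl F (B : Set K)) (k : ℕ) :
    ∀ n, k + 1 ≤ n → PermBound F K k n ∧ SubpermBound F K k n := by
  classical
  induction k with
  | zero => exact fun n _ => ⟨permBound_zero n, subpermBound_zero n⟩
  | succ k ih =>
    have hT : ∀ n, k + 1 + 1 ≤ n → PermBound F K (k + 1) n := by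
      refine Nat.le_induction ?_ fun n hn hT => hT.succ (ih n (by omega)).2
      cases k with
      | zero => exact permBound_one _
      | succ k =>
        intro M hM
        by_cases hz : ∀ i, ∃ c, M i c = 0
        · exact permBound_add_one_of_eq_zero (ih _ (by omega)).1 hM hz
        · push Not at hz
          obtain ⟨i₀, hi₀⟩ := hz
          exact permBound_add_one_of_ne_zero (hE k) hM hi₀
    exact fun n hn => ⟨hT n hn, .succ (by omega) (hT n hn) (ih n (by omega)).2⟩

end dimension

theorem permBound {F : Type*} [Field F] [CharZero F] {K : Type*} [Field K] [Algebra F K] {k n : ℕ}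
    (hn : k + 1 ≤ n) : PermBound F K k n := by
  classical
  exact (permBound_of_normalized (fun _ N hN => ⟨systemOfParameters N,
    card_systemOfParameters_le N, mem_acl_systemOfParameters hN⟩) k n hn).1

theorem le_height_of_permanentalIdeal_le {F : Type*} [Field F] [CharZero F] {k n : ℕ}
    (hn : k + 1 ≤ n) (p : Ideal (MvPolynomial (Fin k × Fin n) F)) [p.IsPrime]
    (hp : permanentalIdeal F k n ≤ p) : (n : ℕ∞) ≤ p.height := by
  let K := FractionRing (MvPolynomial (Fin k × Fin n) F ⧸ p)
  let φ : MvPolynomial (Fin k × Fin n) F →ₐ[F] K :=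
    (IsScalarTower.toAlgHom F (MvPolynomial (Fin k × Fin n) F ⧸ p) K).comp (Ideal.Quotient.mkₐ F p)
  have hker : RingHom.ker φ = p := by
    ext r
    rw [RingHom.mem_ker]
    change algebraMap (MvPolynomial (Fin k × Fin n) F ⧸ p) K (Ideal.Quotient.mk p r) = 0 ↔ _
    rw [FaithfulSMul.algebraMap_eq_zero_iff, Ideal.Quotient.eq_zero_iff_mem]
  have hvan : PermVanish (Matrix.of fun i j => φ (X (i, j))) := by
    apply permVanish_of_strictMono
    intro f hf
    have : perm (Matrix.of fun i j => (X (i, f j) : MvPolynomial (Fin k × Fin n) F)) ∈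
        RingHom.ker φ := by
      rw [hker]
      exact hp (Ideal.subset_span ⟨f, hf, rfl⟩)
    rw [RingHom.mem_ker] at this
    rwa [← AlgHom.coe_toRingHom, ← perm_map] at this
  obtain ⟨B, hB, hmem⟩ := permBound (F := F) hn _ hvan
  have h := card_le_height_ker_add_card φ B fun i => hmem i.1 i.2
  rw [hker] at h
  simp only [Fintype.card_prod, Fintype.card_fin] at h
  have hB' : (n : ℕ∞) + B.card ≤ p.height + B.card := by
    refine le_trans ?_ h
    rw [add_comm]
    exact_mod_cast hB
  exact (ENat.add_le_add_iff_right (ENat.natCast_ne_top _)).1 hB'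

theorem permanentalIdeal_le_span_row (F : Type*) [Field F] (k n : ℕ) :
    permanentalIdeal F (k + 1) n ≤
      Ideal.span (Set.range fun j : Fin n => (X (0, j) : MvPolynomial (Fin (k + 1) × Fin n) F)) := by
  rw [permanentalIdeal, Ideal.span_le]
  rintro _ ⟨c, -, rfl⟩
  refine sum_mem fun σ _ => ?_
  rw [Fin.prod_univ_succ]
  exact Ideal.mul_mem_right _ _ (Ideal.subset_span ⟨_, rfl⟩)

theorem exists_prime_height_le (F : Type*) [Field F] (k n : ℕ) :
    ∃ p : PrimeSpectrum (MvPolynomial (Fin (k + 1) × Fin n) F),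
      permanentalIdeal F (k + 1) n ≤ p.asIdeal ∧ Order.height p ≤ n := by
  classical
  let s : Finset (MvPolynomial (Fin (k + 1) × Fin n) F) := Finset.univ.image fun j => X (0, j)
  have hs : Ideal.span (s : Set (MvPolynomial (Fin (k + 1) × Fin n) F)) ≠ ⊤ := by
    have : Ideal.span (s : Set (MvPolynomial (Fin (k + 1) × Fin n) F)) ≤
        RingHom.ker (MvPolynomial.eval (0 : Fin (k + 1) × Fin n → F)) := by
      rw [Ideal.span_le]
      intro z hz
      obtain ⟨j, -, rfl⟩ := Finset.mem_image.1 hz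
      simp [RingHom.mem_ker]
    exact fun h => RingHom.ker_ne_top _ (top_le_iff.1 (h ▸ this))
  obtain ⟨p, hp⟩ := Ideal.nonempty_minimalPrimes hs
  refine ⟨⟨p, hp.1.1⟩, ?_, ?_⟩
  · refine (permanentalIdeal_le_span_row F k n).trans (le_trans ?_ hp.1.2)
    exact Ideal.span_mono (by simp [s])
  · rw [← PrimeSpectrum.height_eq_orderHeight]
    refine (Ideal.height_le_card_of_mem_minimalPrimes_span_finset hp).trans ?_
    exact_mod_cast Finset.card_image_le.trans_eq (by simp)

/-- For a field `F` of characteristic zero, `2 ≤ k ≤ 5` and `n ≥ k + 1`, the maximal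
permanental ideal `I_{k,n}` has height `n`: the codimension of `P_{k,n}` in `F^{k×n}`
is `n`. -/
theorem statement13 (F : Type*) [Field F] [CharZero F] (k n : ℕ)
    (hk2 : 2 ≤ k) (hk5 : k ≤ 5) (hn : k + 1 ≤ n) :
    idealHeight (permanentalIdeal F k n) = (n : ℕ∞) := by
  apply le_antisymm
  · obtain ⟨k, rfl⟩ := Nat.exists_eq_add_of_le' (one_le_two.trans hk2)
    obtain ⟨p, hp, hpn⟩ := exists_prime_height_le F k n
    exact (iInf₂_le p hp).trans hpn
  · refine le_iInf₂ fun p hp => ?_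
    rw [← PrimeSpectrum.height_eq_orderHeight]
    exact le_height_of_permanentalIdeal_le hn p.asIdeal hp

end
end

section
/- Let k ≥ 6 and let S_k ⊆ MvPolynomial (Fin k × Fin k) ℂ be the ideal generated by the permanents of all (k−1)×(k−1) submatrices of the generic k×k matrix over ℂ. Then 6 ≤ Ideal.height S_k ≤ 2k; equivalently, the singular locus Sing(P) = {prk(M) ≤ k−2} of the permanental hypersurface P = {perm(M) = 0} ⊂ ℂ^{k×k} has codimension between 6 and 2k. -/
open MvPolynomial

noncomputable section

/-- The ideal `S_k` generated by the permanents of all `(k-1) × (k-1)` submatrices of the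
generic `k × k` matrix over `ℂ`; its vanishing locus is the singular locus of the
permanental hypersurface `P = {perm(M) = 0} ⊂ ℂ^{k×k}`. -/
def singularIdeal (k : ℕ) : Ideal (MvPolynomial (Fin k × Fin k) ℂ) :=
  Ideal.span { p | ∃ r c : Fin (k - 1) → Fin k, StrictMono r ∧ StrictMono c ∧
    p = perm (Matrix.of fun a b => X (r a, c b)) }


section Subpermanent

variable {I J R : Type*} [Fintype J] [CommRing R]

/-- The permanent of the submatrix of `N` with rows `s` and columns `t`, as a coefficient of a
product of linear forms. It vanishes unless `s` and `t` have the same cardinality. -/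
def subperm (N : I → J → R) (s : Finset I) (t : Finset J) : R :=
  coeff (∑ j ∈ t, Finsupp.single j 1) (∏ i ∈ s, ∑ j, C (N i j) * X j)

lemma sum_single_one_apply {J : Type*} [DecidableEq J] (t : Finset J) (b : J) :
    (∑ j ∈ t, Finsupp.single j 1 : J →₀ ℕ) b = if b ∈ t then 1 else 0 := by
  simp [Finsupp.finsetSum_apply, Finsupp.single_apply]

/-- Laplace expansion of a subpermanent along a row. -/
lemma subperm_insert [DecidableEq I] [DecidableEq J] (N : I → J → R) {a : I} {s : Finset I}
    (ha : a ∉ s) (t : Finset J) :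
    subperm N (insert a s) t = ∑ b ∈ t, N a b * subperm N s (t.erase b) := by
  unfold subperm
  rw [Finset.prod_insert ha, Finset.sum_mul, coeff_sum, ← Finset.sum_subset (Finset.subset_univ t)]
  · refine Finset.sum_congr rfl fun b hb => ?_
    rw [mul_assoc, coeff_C_mul, ← Finset.add_sum_erase t _ hb, coeff_X_mul]
  · intro b _ hb
    rw [mul_assoc, coeff_C_mul, coeff_X_mul', if_neg, mul_zero]
    simp [Finsupp.mem_support_iff, sum_single_one_apply, hb]

lemma subperm_eq_sum [DecidableEq I] [DecidableEq J] (N : I → J → R) {a : I} {s : Finset I}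
    (ha : a ∈ s) (t : Finset J) :
    subperm N s t = ∑ b ∈ t, N a b * subperm N (s.erase a) (t.erase b) := by
  conv_lhs => rw [← Finset.insert_erase ha]
  exact subperm_insert N (Finset.notMem_erase a s) t

lemma subperm_empty (N : I → J → R) : subperm N ∅ ∅ = 1 := by
  simp [subperm]

lemma subperm_empty_mem (N : I → J → R) (t : Finset J) (E : Subring R) : subperm N ∅ t ∈ E := by
  classical
  simp only [subperm, Finset.prod_empty, coeff_one]
  split_ifs
  exacts [E.one_mem, E.zero_mem]

lemma subperm_mem [DecidableEq I] [DecidableEq J] (N : I → J → R) (E : Subring R)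
    (s : Finset I) (t : Finset J)
    (h : ∀ i ∈ s, ∀ j ∈ t, N i j ∈ E) : subperm N s t ∈ E := by
  induction s using Finset.induction_on generalizing t with
  | empty => exact subperm_empty_mem N t E
  | insert a s ha ih =>
    rw [subperm_insert N ha]
    refine E.sum_mem fun b hb => E.mul_mem (h a (Finset.mem_insert_self a s) b hb) (ih _ ?_)
    exact fun i hi j hj => h i (Finset.mem_insert_of_mem hi) j (Finset.mem_of_mem_erase hj)

/-- The permanent of a submatrix given by injections of indices is a subpermanent. -/
lemma perm_eq_subperm [DecidableEq J] (N : I → J → R) {m : ℕ} (r : Fin m ↪ I)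
    (c : Fin m ↪ J) :
    perm (Matrix.of fun a b => N (r a) (c b)) =
      subperm N (Finset.univ.map r) (Finset.univ.map c) := by
  have key : ∀ f : Fin m → J,
      coeff (∑ j ∈ Finset.univ.map c, Finsupp.single j 1) (∏ a, (C (N (r a) (f a)) * X (f a))) =
        if (∑ a, Finsupp.single (f a) 1 : J →₀ ℕ) = ∑ a, Finsupp.single (c a) 1 then
          ∏ a, N (r a) (f a) else 0 := by
    intro f
    have : (∏ a, (C (N (r a) (f a)) * X (f a)) : MvPolynomial J R) =
        monomial (∑ a, Finsupp.single (f a) 1) (∏ a, N (r a) (f a)) := by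
      rw [monomial_sum_index, Finset.prod_mul_distrib, map_prod]
      rfl
    rw [this, coeff_monomial, Finset.sum_map]
  unfold perm subperm
  rw [Finset.prod_map, Finset.prod_univ_sum, coeff_sum]
  simp only [key]
  rw [Fintype.piFinset_univ, ← Finset.sum_filter]
  refine Finset.sum_bij (fun σ _ => c ∘ σ) ?_ ?_ ?_ ?_
  · intro σ _
    simpa using Equiv.sum_comp σ fun a => (Finsupp.single (c a) 1 : J →₀ ℕ)
  · intro σ _ τ _ h
    exact Equiv.ext fun a => c.injective (congrFun h a)
  · intro f hf
    have hf' := (Finset.mem_filter.mp hf).2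
    have hex : ∀ a, ∃ b, f b = c a := by
      intro a
      by_contra! hne
      have := DFunLike.congr_fun hf' (c a)
      simp [Finsupp.finsetSum_apply, Finsupp.single_apply, hne] at this
    choose τ hτ using hex
    have hτi : Function.Injective τ := fun a b hab => c.injective (by rw [← hτ, ← hτ, hab])
    let e := Equiv.ofBijective τ (Finite.injective_iff_bijective.mp hτi)
    refine ⟨e.symm, Finset.mem_univ _, funext fun a => ?_⟩
    rw [Function.comp_apply, ← hτ]
    exact congrArg f (e.apply_symm_apply a)
  · intro σ _
    rfl

end Subpermanent

section Redundant

variable {I J L : Type*} [Fintype J] [DecidableEq I] [DecidableEq J] [Field L]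

/-- If a subpermanent vanishes, an entry with nonzero cofactor lies in any field containing the
remaining entries. -/
lemma entry_mem (N : I → J → L) {s : Finset I} {t : Finset J} {i : I} {j : J} (hi : i ∈ s)
    (hj : j ∈ t) (h0 : subperm N s t = 0) (h1 : subperm N (s.erase i) (t.erase j) ≠ 0)
    (E : Subfield L) (hE : ∀ a ∈ s, ∀ b ∈ t, (a, b) ≠ (i, j) → N a b ∈ E) : N i j ∈ E := by
  rw [subperm_eq_sum N hi, ← Finset.add_sum_erase t _ hj] at h0
  have hrest : ∑ b ∈ t.erase j, N i b * subperm N (s.erase i) (t.erase b) ∈ E := by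
    refine E.sum_mem fun b hb => E.mul_mem ?_ (subperm_mem N E.toSubring _ _ ?_)
    · exact hE i hi b (Finset.mem_of_mem_erase hb) (by simp [Finset.ne_of_mem_erase hb])
    · intro a ha b' hb'
      exact hE a (Finset.mem_of_mem_erase ha) b' (Finset.mem_of_mem_erase hb')
        (by simp [Finset.ne_of_mem_erase ha])
  have hcof : subperm N (s.erase i) (t.erase j) ∈ E := by
    refine subperm_mem N E.toSubring _ _ fun a ha b hb => ?_
    exact hE a (Finset.mem_of_mem_erase ha) b (Finset.mem_of_mem_erase hb)
      (by simp [Finset.ne_of_mem_erase ha])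
  rw [show N i j = -(∑ b ∈ t.erase j, N i b * subperm N (s.erase i) (t.erase b)) /
    subperm N (s.erase i) (t.erase j) by rw [eq_div_iff h1]; linear_combination h0]
  exact E.div_mem (E.neg_mem hrest) hcof

/-- Two entries in the rows `T` lie in every field containing the remaining entries of these
rows. -/
def HasRedundantPair (N : I → J → L) (T : Finset I) : Prop :=
  ∃ p q : I × J, p ≠ q ∧ p.1 ∈ T ∧ q.1 ∈ T ∧ ∀ E : Subfield L,
    (∀ a ∈ T, ∀ b, (a, b) ≠ p → (a, b) ≠ q → N a b ∈ E) → N p.1 p.2 ∈ E ∧ N q.1 q.2 ∈ E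

/-- Two distinct vanishing subpermanents make two entries redundant. -/
lemma hasRedundantPair_of_subperm_eq_zero (N : I → J → L) (T : Finset I) (m : ℕ) :
    ∀ (s s' : Finset I) (t t' : Finset J), s ⊆ T → s' ⊆ T → s.card = m → s'.card = m →
      t.card = m → t'.card = m → (s, t) ≠ (s', t') → subperm N s t = 0 → subperm N s' t' = 0 →
      HasRedundantPair N T := by
  induction m with
  | zero =>
    intro s s' t t' _ _ hs hs' ht ht' hne
    simp_all
  | succ m ih =>
    intro s s' t t' hsT hsT' hs hs' ht ht' hne h0 h0'
    have m_pos : ∀ s : Finset I, ∀ t : Finset J, s.card = m + 1 → t.card = m + 1 →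
        ∀ i ∈ s, ∀ j ∈ t, subperm N (s.erase i) (t.erase j) = 0 → m ≠ 0 := by
      rintro s t hs ht i hi j hj h rfl
      have e1 : s.erase i = ∅ := by
        rw [← Finset.card_eq_zero, Finset.card_erase_of_mem hi, hs]
      have e2 : t.erase j = ∅ := by
        rw [← Finset.card_eq_zero, Finset.card_erase_of_mem hj, ht]
      rw [e1, e2, subperm_empty] at h
      exact one_ne_zero h
    have col : ∀ s : Finset I, ∀ t : Finset J, s ⊆ T → s.card = m + 1 → t.card = m + 1 →
        ∀ j ∈ t, (∀ i ∈ s, subperm N (s.erase i) (t.erase j) = 0) → HasRedundantPair N T := by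
      intro s t hsT hs ht j hj h
      obtain ⟨i, hi⟩ : s.Nonempty := by rw [← Finset.card_pos]; omega
      have hm := m_pos s t hs ht i hi j hj (h i hi)
      obtain ⟨i₁, hi₁, i₂, hi₂, hne⟩ := Finset.one_lt_card.mp (show 1 < s.card by omega)
      refine ih (s.erase i₁) (s.erase i₂) (t.erase j) (t.erase j)
        ((Finset.erase_subset _ _).trans hsT) ((Finset.erase_subset _ _).trans hsT)
        (by rw [Finset.card_erase_of_mem hi₁, hs]; rfl)
        (by rw [Finset.card_erase_of_mem hi₂, hs]; rfl)
        (by rw [Finset.card_erase_of_mem hj, ht]; rfl)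
        (by rw [Finset.card_erase_of_mem hj, ht]; rfl) ?_ (h i₁ hi₁) (h i₂ hi₂)
      intro he
      have := (Prod.ext_iff.mp he).1
      have h2 : i₂ ∈ s.erase i₁ := Finset.mem_erase.mpr ⟨hne.symm, hi₂⟩
      simp only at this
      rw [this] at h2
      exact Finset.notMem_erase _ _ h2
    have row : ∀ s : Finset I, ∀ t : Finset J, s ⊆ T → s.card = m + 1 → t.card = m + 1 →
        ∀ i ∈ s, (∀ j ∈ t, subperm N (s.erase i) (t.erase j) = 0) → HasRedundantPair N T := by
      intro s t hsT hs ht i hi h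
      obtain ⟨j, hj⟩ : t.Nonempty := by rw [← Finset.card_pos]; omega
      have hm := m_pos s t hs ht i hi j hj (h j hj)
      obtain ⟨j₁, hj₁, j₂, hj₂, hne⟩ := Finset.one_lt_card.mp (show 1 < t.card by omega)
      refine ih (s.erase i) (s.erase i) (t.erase j₁) (t.erase j₂)
        ((Finset.erase_subset _ _).trans hsT) ((Finset.erase_subset _ _).trans hsT)
        (by rw [Finset.card_erase_of_mem hi, hs]; rfl)
        (by rw [Finset.card_erase_of_mem hi, hs]; rfl)
        (by rw [Finset.card_erase_of_mem hj₁, ht]; rfl)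
        (by rw [Finset.card_erase_of_mem hj₂, ht]; rfl) ?_ (h j₁ hj₁) (h j₂ hj₂)
      intro he
      have := (Prod.ext_iff.mp he).2
      have h2 : j₂ ∈ t.erase j₁ := Finset.mem_erase.mpr ⟨hne.symm, hj₂⟩
      simp only at this
      rw [this] at h2
      exact Finset.notMem_erase _ _ h2
    have finish : ∀ i ∈ s, ∀ j ∈ t, ∀ i' ∈ s', ∀ j' ∈ t', ((i ∉ s' ∧ i' ∉ s) ∨ (j ∉ t' ∧ j' ∉ t)) →
        subperm N (s.erase i) (t.erase j) ≠ 0 → subperm N (s'.erase i') (t'.erase j') ≠ 0 →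
        HasRedundantPair N T := by
      intro i hi j hj i' hi' j' hj' hd hne hne'
      refine ⟨(i, j), (i', j'), ?_, hsT hi, hsT' hi', fun E hE => ⟨?_, ?_⟩⟩
      · intro he
        obtain ⟨rfl, rfl⟩ := Prod.ext_iff.mp he
        rcases hd with hd | hd
        exacts [hd.1 hi', hd.1 hj']
      · refine entry_mem N hi hj h0 hne E fun a ha b hb hab => hE a (hsT ha) b hab ?_
        intro he
        obtain ⟨rfl, rfl⟩ := Prod.ext_iff.mp he
        rcases hd with hd | hd
        exacts [hd.2 ha, hd.2 hb]
      · refine entry_mem N hi' hj' h0' hne' E fun a ha b hb hab => hE a (hsT' ha) b ?_ hab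
        intro he
        obtain ⟨rfl, rfl⟩ := Prod.ext_iff.mp he
        rcases hd with hd | hd
        exacts [hd.1 ha, hd.1 hb]
    by_cases hst : s = s'
    · have htt : t ≠ t' := fun h => hne (by rw [hst, h])
      obtain ⟨j, hj, hj'⟩ := Finset.not_subset.mp fun h =>
        htt (Finset.eq_of_subset_of_card_le h (by omega))
      obtain ⟨l, hl, hl'⟩ := Finset.not_subset.mp fun h =>
        htt (Finset.eq_of_subset_of_card_le h (by omega)).symm
      by_cases h1 : ∀ i ∈ s, subperm N (s.erase i) (t.erase j) = 0
      · exact col s t hsT hs ht j hj h1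
      by_cases h2 : ∀ i ∈ s', subperm N (s'.erase i) (t'.erase l) = 0
      · exact col s' t' hsT' hs' ht' l hl h2
      push Not at h1 h2
      obtain ⟨i, hi, h1⟩ := h1
      obtain ⟨i', hi', h2⟩ := h2
      exact finish i hi j hj i' hi' l hl (Or.inr ⟨hj', hl'⟩) h1 h2
    · obtain ⟨i, hi, hi'⟩ := Finset.not_subset.mp fun h =>
        hst (Finset.eq_of_subset_of_card_le h (by omega))
      obtain ⟨l, hl, hl'⟩ := Finset.not_subset.mp fun h =>
        hst (Finset.eq_of_subset_of_card_le h (by omega)).symm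
      by_cases h1 : ∀ j ∈ t, subperm N (s.erase i) (t.erase j) = 0
      · exact row s t hsT hs ht i hi h1
      by_cases h2 : ∀ j ∈ t', subperm N (s'.erase l) (t'.erase j) = 0
      · exact row s' t' hsT' hs' ht' l hl h2
      push Not at h1 h2
      obtain ⟨j, hj, h1⟩ := h1
      obtain ⟨j', hj', h2⟩ := h2
      exact finish i hi j hj l hl j' hj' (Or.inl ⟨hi', hl'⟩) h1 h2

end Redundant

section Height

/-- If a prime ideal `p` of a polynomial ring is the kernel of evaluation at a point `v` of a field
extension and the coordinates of `v` indexed by `S` lie in the field generated by the other ones,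
then `p` has height at least the cardinality of `S`. -/
lemma card_le_height_ker_aeval {σ K L : Type*} [DecidableEq σ] [Field K] [Field L] [Algebra K L]
    (v : σ → L) (S : Finset σ)
    (hS : ∀ i ∈ S, v i ∈ IntermediateField.adjoin K (Set.range fun j : {j // j ∉ S} => v j)) :
    (S.card : ℕ∞) ≤ (RingHom.ker (aeval v : MvPolynomial σ K →ₐ[K] L)).height := by
  let ψ (T : Finset σ) : MvPolynomial σ K →ₐ[K] MvPolynomial σ L :=
    aeval fun i => if i ∈ T then X i else C (v i)
  have hψv : ∀ T, T ⊆ S → ∀ r : MvPolynomial {j // j ∉ S} K,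
      ψ T (rename Subtype.val r) = C (aeval (fun j : {j // j ∉ S} => v j) r) := by
    intro T hT r
    have : ((ψ T).comp (rename Subtype.val)) =
        (IsScalarTower.toAlgHom K L (MvPolynomial σ L)).comp
          (aeval (fun j : {j // j ∉ S} => v j)) := by
      ext j
      simp [ψ, show (j : σ) ∉ T from fun h => j.2 (hT h), algebraMap_eq]
    simpa [algebraMap_eq] using DFunLike.congr_fun this r
  have hlt : ∀ T : Finset σ, ∀ s ∈ S, s ∉ T → insert s T ⊆ S →
      RingHom.ker (ψ (insert s T)) < RingHom.ker (ψ T) := by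
    intro T s hs hsT hTS
    obtain ⟨α, β, hβ, hv⟩ : ∃ α β : MvPolynomial {j // j ∉ S} K,
        aeval (fun j : {j // j ∉ S} => v j) β ≠ 0 ∧
        v s * aeval (fun j : {j // j ∉ S} => v j) β = aeval (fun j : {j // j ∉ S} => v j) α := by
      obtain ⟨α, β, h⟩ := (IntermediateField.mem_adjoin_range_iff K _ _).mp (hS s hs)
      by_cases hβ : aeval (fun j : {j // j ∉ S} => v j) β = 0
      · exact ⟨0, 1, by simp, by simp [h, hβ]⟩
      · exact ⟨α, β, hβ, by rw [h, div_mul_cancel₀ _ hβ]⟩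
    refine lt_of_le_not_ge ?_ fun hle => ?_
    · have hfac : ψ T = ((aeval fun i => if i = s then C (v s) else X i :
          MvPolynomial σ L →ₐ[L] MvPolynomial σ L).restrictScalars K).comp (ψ (insert s T)) := by
        ext i : 1
        by_cases his : i = s
        · subst his
          simp [ψ, hsT]
        · by_cases hiT : i ∈ T
          · simp [ψ, his, hiT]
          · simp [ψ, his, hiT, algebraMap_eq]
      intro x hx
      rw [RingHom.mem_ker] at hx ⊢
      rw [hfac, AlgHom.comp_apply, hx, map_zero]
    · have hmem : X s * rename Subtype.val β - rename Subtype.val α ∈ RingHom.ker (ψ T) := by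
        rw [RingHom.mem_ker, map_sub, map_mul, hψv T ((Finset.subset_insert s T).trans hTS),
          hψv T ((Finset.subset_insert s T).trans hTS), ← hv]
        simp [ψ, hsT]
      have h2 := hle hmem
      rw [RingHom.mem_ker, map_sub, map_mul, hψv _ hTS, hψv _ hTS] at h2
      rw [show ψ (insert s T) (X s) = X s by simp [ψ]] at h2
      have h3 := congrArg (coeff (Finsupp.single s 1)) h2
      rw [coeff_sub, mul_comm, coeff_C_mul, coeff_X, coeff_C,
        if_pos rfl, if_neg (Finsupp.single_ne_zero.mpr one_ne_zero).symm, coeff_zero, sub_zero,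
        mul_one] at h3
      exact hβ h3
  have hmain : ∀ T : Finset σ, T ⊆ S →
      (T.card : ℕ∞) ≤ (RingHom.ker (ψ (S \ T))).height := by
    intro T
    induction T using Finset.induction_on with
    | empty => simp
    | insert s T hs ih =>
      intro hT
      have hins : insert s (S \ insert s T) = S \ T := by
        ext i
        have := hT (Finset.mem_insert_self s T)
        by_cases his : i = s <;> simp_all
      have h := hlt (S \ insert s T) s (hT (Finset.mem_insert_self s T)) (by simp)
        (by rw [hins]; exact Finset.sdiff_subset)
      rw [hins] at h
      have : (RingHom.ker (ψ (S \ T))).IsPrime := RingHom.ker_isPrime _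
      have : (RingHom.ker (ψ (S \ insert s T))).IsPrime := RingHom.ker_isPrime _
      rw [Finset.card_insert_of_notMem hs, Nat.cast_add, Nat.cast_one]
      refine le_trans ?_ (Ideal.height_add_one_le_of_lt_of_isPrime h)
      gcongr
      exact ih ((Finset.subset_insert s T).trans hT)
  have h := hmain S subset_rfl
  rw [Finset.sdiff_self] at h
  convert h using 2
  ext x
  have : ψ ∅ = (IsScalarTower.toAlgHom K L (MvPolynomial σ L)).comp (aeval v) := by
    ext i
    simp [ψ, algebraMap_eq]
  rw [RingHom.mem_ker, RingHom.mem_ker, this, AlgHom.comp_apply, IsScalarTower.coe_toAlgHom',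
    algebraMap_eq, C_eq_zero]

end Height

section Square

variable {k : ℕ} {L : Type*} [Field L]

/-- The relation expressing the vanishing of the subpermanent with rows `insert x s` that omits
the column `i`, with all terms except those of two columns `j` and `l` collected in `e`. -/
lemma exists_row_relation (N : Fin k → Fin k → L) {s : Finset (Fin k)} {x i j l : Fin k}
    (hx : x ∉ s) (hji : j ≠ i) (hli : l ≠ i) (hjl : j ≠ l)
    (h0 : subperm N (insert x s) {i}ᶜ = 0) (E : Subfield L) (hs : ∀ a ∈ s, ∀ b, N a b ∈ E)
    (hE : ∀ b, b ≠ i → b ≠ j → b ≠ l → N x b ∈ E) :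
    ∃ e ∈ E, subperm N s {i, j}ᶜ * N x j + subperm N s {i, l}ᶜ * N x l = e := by
  have herase : ∀ b, ({i}ᶜ : Finset (Fin k)).erase b = {i, b}ᶜ := by
    intro b
    ext c
    simp only [Finset.mem_erase, Finset.mem_compl, Finset.mem_singleton, Finset.mem_insert]
    tauto
  rw [subperm_insert N hx, ← Finset.add_sum_erase _ _ (show j ∈ ({i}ᶜ : Finset (Fin k)) by simpa),
    ← Finset.add_sum_erase _ _
      (show l ∈ ({i}ᶜ : Finset (Fin k)).erase j by simpa using ⟨hjl.symm, hli⟩)] at h0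
  simp only [herase] at h0
  refine ⟨-∑ b ∈ ({i, j}ᶜ : Finset (Fin k)).erase l, N x b * subperm N s {i, b}ᶜ,
    E.neg_mem (E.sum_mem fun b hb => E.mul_mem ?_ ?_), by linear_combination h0⟩
  · simp only [Finset.mem_erase, Finset.mem_compl, Finset.mem_singleton, Finset.mem_insert,
      not_or] at hb
    exact hE b hb.2.1 hb.2.2 hb.1
  · exact subperm_mem N E.toSubring _ _ fun a ha b _ => hs a ha b

/-- Three columns with pairwise nonvanishing complementary subpermanents determine the three
corresponding entries of a further row. -/
lemma entries_mem_of_triangle (h2 : (2 : L) ≠ 0) (N : Fin k → Fin k → L) {s : Finset (Fin k)}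
    {x i j l : Fin k} (hx : x ∉ s) (hij : i ≠ j) (hil : i ≠ l) (hjl : j ≠ l)
    (h0 : ∀ c, subperm N (insert x s) {c}ᶜ = 0) (hbij : subperm N s {i, j}ᶜ ≠ 0)
    (hbil : subperm N s {i, l}ᶜ ≠ 0) (hbjl : subperm N s {j, l}ᶜ ≠ 0) (E : Subfield L)
    (hs : ∀ a ∈ s, ∀ b, N a b ∈ E) (hE : ∀ b, b ≠ i → b ≠ j → b ≠ l → N x b ∈ E) :
    N x i ∈ E ∧ N x j ∈ E ∧ N x l ∈ E := by
  have hmem : ∀ t, subperm N s t ∈ E := fun t =>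
    subperm_mem N E.toSubring _ _ fun a ha b _ => hs a ha b
  have h2E : (2 : L) ∈ E := by
    rw [← one_add_one_eq_two]
    exact E.add_mem E.one_mem E.one_mem
  obtain ⟨e₁, he₁, h₁⟩ := exists_row_relation N hx hij.symm hil.symm hjl (h0 i) E hs hE
  obtain ⟨e₂, he₂, h₂⟩ := exists_row_relation N hx hij hjl.symm hil (h0 j) E hs
    fun b hb hb' hb'' => hE b hb' hb hb''
  obtain ⟨e₃, he₃, h₃⟩ := exists_row_relation N hx hil hjl hij (h0 l) E hs
    fun b hb hb' hb'' => hE b hb' hb'' hb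
  rw [Finset.pair_comm j i] at h₂
  rw [Finset.pair_comm l i, Finset.pair_comm l j] at h₃
  have hm₁ := hmem {i, j}ᶜ
  have hm₂ := hmem {i, l}ᶜ
  have hm₃ := hmem {j, l}ᶜ
  generalize subperm N s {i, j}ᶜ = p at *
  generalize subperm N s {i, l}ᶜ = q at *
  generalize subperm N s {j, l}ᶜ = r at *
  refine ⟨?_, ?_, ?_⟩
  · rw [show N x i = (q * e₂ + p * e₃ - r * e₁) / (2 * p * q) by
      rw [eq_div_iff (mul_ne_zero (mul_ne_zero h2 hbij) hbil)]
      linear_combination q * h₂ + p * h₃ - r * h₁]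
    exact E.div_mem (E.sub_mem (E.add_mem (E.mul_mem hm₂ he₂) (E.mul_mem hm₁ he₃))
      (E.mul_mem hm₃ he₁)) (E.mul_mem (E.mul_mem h2E hm₁) hm₂)
  · rw [show N x j = (r * e₁ + p * e₃ - q * e₂) / (2 * p * r) by
      rw [eq_div_iff (mul_ne_zero (mul_ne_zero h2 hbij) hbjl)]
      linear_combination r * h₁ + p * h₃ - q * h₂]
    exact E.div_mem (E.sub_mem (E.add_mem (E.mul_mem hm₃ he₁) (E.mul_mem hm₁ he₃))
      (E.mul_mem hm₂ he₂)) (E.mul_mem (E.mul_mem h2E hm₁) hm₃)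
  · rw [show N x l = (r * e₁ + q * e₂ - p * e₃) / (2 * q * r) by
      rw [eq_div_iff (mul_ne_zero (mul_ne_zero h2 hbil) hbjl)]
      linear_combination r * h₁ + q * h₂ - p * h₃]
    exact E.div_mem (E.sub_mem (E.add_mem (E.mul_mem hm₃ he₁) (E.mul_mem hm₂ he₂))
      (E.mul_mem hm₁ he₃)) (E.mul_mem (E.mul_mem h2E hm₂) hm₃)

/-- A nonvanishing subpermanent all of whose extensions by a row and a column vanish makes the
complementary block of entries redundant. -/
lemma compl_block_mem (N : Fin k → Fin k → L) {s t : Finset (Fin k)} (hne : subperm N s t ≠ 0)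
    (h0 : ∀ a ∉ s, ∀ b ∉ t, subperm N (insert a s) (insert b t) = 0) (E : Subfield L)
    (hE : ∀ a b, (a, b) ∉ sᶜ ×ˢ tᶜ → N a b ∈ E) (a b : Fin k) (hab : (a, b) ∈ sᶜ ×ˢ tᶜ) :
    N a b ∈ E := by
  obtain ⟨ha, hb⟩ : a ∉ s ∧ b ∉ t := by simpa using hab
  refine entry_mem N (Finset.mem_insert_self a s) (Finset.mem_insert_self b t) (h0 a ha b hb)
    (by rwa [Finset.erase_insert ha, Finset.erase_insert hb]) E fun c hc d hd hcd => hE c d ?_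
  simp only [Finset.mem_product, Finset.mem_compl, Finset.mem_insert, ne_eq, Prod.mk.injEq] at *
  tauto

/-- If all `(k - 1) × (k - 1)` subpermanents of a `k × k` matrix over a field vanish, then six
entries lie in the field generated by the other ones. -/
lemma exists_six_redundant (hk : 6 ≤ k) (h2 : (2 : L) ≠ 0) (N : Fin k → Fin k → L)
    (h : ∀ s t : Finset (Fin k), s.card = k - 1 → t.card = k - 1 → subperm N s t = 0) :
    ∃ S : Finset (Fin k × Fin k), 6 ≤ S.card ∧ ∀ E : Subfield L,
      (∀ a b, (a, b) ∉ S → N a b ∈ E) → ∀ a b, (a, b) ∈ S → N a b ∈ E := by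
  by_cases hQ : ∃ s t : Finset (Fin k), s.card = k - 2 ∧ t.card = k - 2 ∧ subperm N s t ≠ 0
  · obtain ⟨s, t, hs, ht, hne⟩ := hQ
    have hs2 : sᶜ.card = 2 := by rw [Finset.card_compl, Fintype.card_fin]; omega
    have ht2 : tᶜ.card = 2 := by rw [Finset.card_compl, Fintype.card_fin]; omega
    obtain ⟨x, y, hxy, hsxy⟩ := Finset.card_eq_two.mp hs2
    have hs_iff : ∀ a, a ∉ s ↔ a = x ∨ a = y := by
      intro a
      rw [← Finset.mem_compl, hsxy]
      simp
    have hx : x ∉ s := (hs_iff x).mpr (Or.inl rfl)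
    have hy : y ∉ s := (hs_iff y).mpr (Or.inr rfl)
    have h0 : ∀ x, x ∉ s → ∀ c, subperm N (insert x s) {c}ᶜ = 0 := by
      intro x hx c
      refine h _ _ ?_ ?_
      · rw [Finset.card_insert_of_notMem hx]; omega
      · rw [Finset.card_compl, Fintype.card_fin, Finset.card_singleton]
    by_cases htri : ∃ i j l : Fin k, i ≠ j ∧ i ≠ l ∧ j ≠ l ∧ subperm N s {i, j}ᶜ ≠ 0 ∧
        subperm N s {i, l}ᶜ ≠ 0 ∧ subperm N s {j, l}ᶜ ≠ 0
    · obtain ⟨i, j, l, hij, hil, hjl, hbij, hbil, hbjl⟩ := htri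
      refine ⟨sᶜ ×ˢ {i, j, l}, ?_, fun E hE a b hab => ?_⟩
      · rw [Finset.card_product, hs2, Finset.card_eq_three.mpr ⟨i, j, l, hij, hil, hjl, rfl⟩]
      · obtain ⟨ha, hb⟩ : a ∉ s ∧ (b = i ∨ b = j ∨ b = l) := by simpa using hab
        have := entries_mem_of_triangle h2 N ha hij hil hjl (h0 a ha) hbij hbil hbjl E
          (fun c hc d => hE c d (by simp [hc])) (fun d hi hj hl => hE a d (by simp [hi, hj, hl]))
        rcases hb with rfl | rfl | rfl
        exacts [this.1, this.2.1, this.2.2]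
    · have hpair : ∀ i j l : Fin k, i ≠ j → i ≠ l → j ≠ l →
          ∃ t : Finset (Fin k), t.card = k - 2 ∧ tᶜ ⊆ {i, j, l} ∧ subperm N s t = 0 := by
        intro i j l hij hil hjl
        have hcard : ∀ a b : Fin k, a ≠ b → ({a, b}ᶜ : Finset (Fin k)).card = k - 2 := by
          intro a b hab
          rw [Finset.card_compl, Finset.card_pair hab, Fintype.card_fin]
        by_contra! hall
        refine htri ⟨i, j, l, hij, hil, hjl, hall _ (hcard _ _ hij) ?_, hall _ (hcard _ _ hil) ?_,
          hall _ (hcard _ _ hjl) ?_⟩ <;>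
        · rw [compl_compl]
          intro c
          simp only [Finset.mem_insert, Finset.mem_singleton]
          tauto
      obtain ⟨t₁, hc₁, hsub₁, hz₁⟩ := hpair ⟨0, by omega⟩ ⟨1, by omega⟩ ⟨2, by omega⟩
        (by simp) (by simp) (by simp)
      obtain ⟨t₂, hc₂, hsub₂, hz₂⟩ := hpair ⟨3, by omega⟩ ⟨4, by omega⟩ ⟨5, by omega⟩
        (by simp) (by simp) (by simp)
      have ht₁₂ : t₁ ≠ t₂ := by
        rintro rfl
        obtain ⟨c, hc⟩ : t₁ᶜ.Nonempty := by
          rw [← Finset.card_pos, Finset.card_compl, Fintype.card_fin]; omega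
        have h₁ := hsub₁ hc
        have h₂ := hsub₂ hc
        simp only [Finset.mem_insert, Finset.mem_singleton, Fin.ext_iff] at h₁ h₂
        omega
      obtain ⟨p, q, hpq, hp, hq, hmem⟩ := hasRedundantPair_of_subperm_eq_zero N s (k - 2)
        s s t₁ t₂ subset_rfl subset_rfl hs hs hc₁ hc₂
        (fun he => ht₁₂ (Prod.ext_iff.mp he).2) hz₁ hz₂
      have hdisj : Disjoint (sᶜ ×ˢ tᶜ) ({p, q} : Finset (Fin k × Fin k)) := by
        rw [Finset.disjoint_left]
        rintro ⟨a, b⟩ hab hab'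
        simp only [Finset.mem_product, Finset.mem_compl, Finset.mem_insert,
          Finset.mem_singleton] at hab hab'
        rcases hab' with rfl | rfl
        exacts [hab.1 hp, hab.1 hq]
      refine ⟨sᶜ ×ˢ tᶜ ∪ {p, q}, ?_, fun E hE => ?_⟩
      · rw [Finset.card_union_of_disjoint hdisj, Finset.card_product, hs2, ht2,
          Finset.card_pair hpq]
      · obtain ⟨hpE, hqE⟩ := hmem E fun a ha b hp hq => hE a b (by simp [ha, hp, hq])
        have hE' : ∀ a b, (a, b) ∉ sᶜ ×ˢ tᶜ → N a b ∈ E := by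
          intro a b hab
          by_cases h1 : (a, b) = p
          · rwa [← h1] at hpE
          by_cases h2 : (a, b) = q
          · rwa [← h2] at hqE
          exact hE a b (by simp_all)
        intro a b _
        by_cases hab : (a, b) ∈ sᶜ ×ˢ tᶜ
        · refine compl_block_mem N hne (fun a ha b hb => h _ _ ?_ ?_) E hE' a b hab
          · rw [Finset.card_insert_of_notMem ha]; omega
          · rw [Finset.card_insert_of_notMem hb]; omega
        · exact hE' a b hab
  · obtain ⟨m, hm, ⟨s, t, hs, ht, hne⟩, hmax⟩ : ∃ m < k - 2,
        (∃ s t : Finset (Fin k), s.card = m ∧ t.card = m ∧ subperm N s t ≠ 0) ∧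
        ¬ ∃ s t : Finset (Fin k), s.card = m + 1 ∧ t.card = m + 1 ∧ subperm N s t ≠ 0 := by
      by_contra! hstep
      refine hQ ?_
      have : ∀ m ≤ k - 2,
          ∃ s t : Finset (Fin k), s.card = m ∧ t.card = m ∧ subperm N s t ≠ 0 := by
        intro m
        induction m with
        | zero => exact fun _ => ⟨∅, ∅, rfl, rfl, by simp [subperm_empty]⟩
        | succ m ih => exact fun hm => hstep m (by omega) (ih (by omega))
      exact this _ le_rfl
    push Not at hmax
    refine ⟨sᶜ ×ˢ tᶜ, ?_, fun E hE => compl_block_mem N hne (fun a ha b hb => hmax _ _ ?_ ?_) E hE⟩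
    · rw [Finset.card_product, Finset.card_compl, Finset.card_compl, Fintype.card_fin, hs, ht]
      have h3 : 3 ≤ k - m := by omega
      exact le_trans (by norm_num) (Nat.mul_le_mul h3 h3)
    · rw [Finset.card_insert_of_notMem ha, hs]
    · rw [Finset.card_insert_of_notMem hb, ht]

end Square

/-- A prime ideal containing all the `(k - 1) × (k - 1)` subpermanents has height at least six. -/
lemma six_le_height_of_singularIdeal_le {k : ℕ} (hk : 6 ≤ k)
    (p : Ideal (MvPolynomial (Fin k × Fin k) ℂ)) [p.IsPrime] (hp : singularIdeal k ≤ p) :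
    6 ≤ p.height := by
  let A := MvPolynomial (Fin k × Fin k) ℂ ⧸ p
  let L := FractionRing A
  let φ : MvPolynomial (Fin k × Fin k) ℂ →ₐ[ℂ] L :=
    (IsScalarTower.toAlgHom ℂ A L).comp (Ideal.Quotient.mkₐ ℂ p)
  let v : Fin k × Fin k → L := fun i => φ (X i)
  have hφ : φ = aeval v := by
    ext i
    simp [v]
  have hker : RingHom.ker (aeval v : MvPolynomial (Fin k × Fin k) ℂ →ₐ[ℂ] L) = p := by
    rw [← hφ]
    ext x
    rw [RingHom.mem_ker, AlgHom.comp_apply, IsScalarTower.coe_toAlgHom',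
      FaithfulSMul.algebraMap_eq_zero_iff, Ideal.Quotient.mkₐ_eq_mk, Ideal.Quotient.eq_zero_iff_mem]
  have h2 : (2 : L) ≠ 0 := by
    have := (map_ne_zero (algebraMap ℂ L)).mpr (two_ne_zero (α := ℂ))
    rwa [map_ofNat] at this
  obtain ⟨S, hS, hmem⟩ := exists_six_redundant hk h2 (fun a b => v (a, b)) (by
    intro s t hs ht
    have hgen : perm (Matrix.of fun a b => X (s.orderEmbOfFin hs a, t.orderEmbOfFin ht b)) ∈ p :=
      hp (Ideal.subset_span ⟨s.orderEmbOfFin hs, t.orderEmbOfFin ht,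
        (s.orderEmbOfFin hs).strictMono, (t.orderEmbOfFin ht).strictMono, rfl⟩)
    rw [← hker, RingHom.mem_ker] at hgen
    have := perm_eq_subperm (fun a b => v (a, b)) (s.orderEmbOfFin hs).toEmbedding
      (t.orderEmbOfFin ht).toEmbedding
    rw [Finset.map_orderEmbOfFin_univ, Finset.map_orderEmbOfFin_univ] at this
    rw [← this, ← hgen]
    simp [perm, map_sum, map_prod])
  rw [← hker]
  refine le_trans (by exact_mod_cast hS) (card_le_height_ker_aeval v S fun i hi => ?_)
  exact hmem (IntermediateField.adjoin ℂ (Set.range fun j : {j // j ∉ S} => v j)).toSubfield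
    (fun a b hab => IntermediateField.subset_adjoin ℂ _ ⟨⟨(a, b), hab⟩, rfl⟩) i.1 i.2 hi

/-- The height of a proper ideal bounds its `idealHeight` from above. -/
lemma idealHeight_le_height {R : Type*} [CommRing R] (I : Ideal R) :
    idealHeight I ≤ I.height := by
  rw [Ideal.height_eq_inf_minimalPrimes]
  refine le_iInf₂ fun J hJ => ?_
  have := hJ.isPrime
  exact (iInf₂_le (⟨J, this⟩ : PrimeSpectrum R) hJ.le).trans_eq
    (PrimeSpectrum.height_eq_orderHeight ⟨J, this⟩).symm

/-- Every `(k - 1) × (k - 1)` submatrix meets one of two given rows. -/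
lemma singularIdeal_le_span {k : ℕ} (x y : Fin k) (hxy : x ≠ y) :
    singularIdeal k ≤ Ideal.span (X '' (({x, y} ×ˢ Finset.univ : Finset (Fin k × Fin k)) :
      Set (Fin k × Fin k))) := by
  refine Ideal.span_le.mpr ?_
  rintro _ ⟨r, c, hr, -, rfl⟩
  obtain ⟨a, ha⟩ : ∃ a, r a = x ∨ r a = y := by
    by_contra! hne
    have hsub : Finset.univ.image r ⊆ {x, y}ᶜ := by
      intro b hb
      obtain ⟨a, -, rfl⟩ := Finset.mem_image.mp hb
      simpa using hne a
    have := Finset.card_le_card hsub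
    rw [Finset.card_image_of_injective _ hr.injective, Finset.card_compl, Finset.card_pair hxy,
      Finset.card_univ, Fintype.card_fin, Fintype.card_fin] at this
    have := x.isLt
    have := y.isLt
    have := Fin.val_ne_of_ne hxy
    omega
  refine Ideal.sum_mem _ fun σ _ => ?_
  rw [← Finset.mul_prod_erase _ _ (Finset.mem_univ a)]
  refine Ideal.mul_mem_right _ _ (Ideal.subset_span ⟨(r a, c (σ a)), ?_, rfl⟩)
  simpa using ha

lemma idealHeight_singularIdeal_le {k : ℕ} (hk : 2 ≤ k) :
    idealHeight (singularIdeal k) ≤ ((2 * k : ℕ) : ℕ∞) := by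
  let x : Fin k := ⟨0, by omega⟩
  let y : Fin k := ⟨1, by omega⟩
  have hxy : x ≠ y := by simp [x, y]
  let T : Finset (Fin k × Fin k) := {x, y} ×ˢ Finset.univ
  let J : Ideal (MvPolynomial (Fin k × Fin k) ℂ) := Ideal.span (X '' (T : Set (Fin k × Fin k)))
  have hJ : J ≠ ⊤ := by
    rw [Ideal.ne_top_iff_one]
    intro h1
    obtain ⟨i, -, hi⟩ := mem_ideal_span_X_image.mp h1 0 (by simp)
    simp at hi
  refine (idealHeight_le_height _).trans ((Ideal.height_mono (singularIdeal_le_span x y hxy)).trans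
    ((Ideal.height_le_spanFinrank J hJ).trans ?_))
  rw [Nat.cast_le]
  refine (Submodule.spanFinrank_span_le_ncard_of_finite (T.finite_toSet.image _)).trans
    ((Set.ncard_image_le T.finite_toSet).trans ?_)
  rw [Set.ncard_coe_finset, Finset.card_product, Finset.card_pair hxy, Finset.card_univ,
    Fintype.card_fin]

/-- For `k ≥ 6`, the singular locus of the `k × k` complex permanental hypersurface has
codimension between `6` and `2k`: `6 ≤ Ideal.height S_k ≤ 2k`. -/
theorem statement16 (k : ℕ) (hk : 6 ≤ k) :
    (6 : ℕ∞) ≤ idealHeight (singularIdeal k) ∧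
      idealHeight (singularIdeal k) ≤ ((2 * k : ℕ) : ℕ∞) := by
  refine ⟨le_iInf₂ fun p hp => ?_, idealHeight_singularIdeal_le (by omega)⟩
  rw [← PrimeSpectrum.height_eq_orderHeight]
  exact six_le_height_of_singularIdeal_le hk p.asIdeal hp

end
end
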